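/- arXiv:2503.21604 — 7 statements merged into one kernel-verified Lean document; each statement's English description precedes it below -/
import Mathlib

section
/- For every R₀ > 0 there exists a constant C₀ > 0 such that for all s ∈ (0, R₀] one has |F(s) + (1/2)·ln s| ≤ C₀, where F(s) = ∫₀^{π/2} cos(2θ)/√(sin²θ + s/4) dθ. -/
/-- The profile function of the Green kernel of the axisymmetric operator
`div((1/r)∇·)` on the half-plane:
`F(s) = ∫₀^{π/2} cos(2θ)/√(sin²θ + s/4) dθ`. -/
noncomputable def F (s : ℝ) : ℝ :=
  ∫ θ in (0:ℝ)..(Real.pi/2), Real.cos (2*θ) / Real.sqrt (Real.sin θ ^ 2 + s/4)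

open Real in
theorem integral_cos_div_sqrt_sin_sq_add {b : ℝ} (hb : 0 < b) :
    ∫ θ in (0:ℝ)..(π / 2), cos θ / √(sin θ ^ 2 + b) = log (1 + √(1 + b)) - log b / 2 := by
  have hpos : ∀ θ : ℝ, 0 < sin θ ^ 2 + b := fun θ => by positivity
  have hsum : ∀ θ : ℝ, 0 < sin θ + √(sin θ ^ 2 + b) := fun θ => by
    have : -sin θ < √(sin θ ^ 2 + b) := Real.lt_sqrt_of_sq_lt (by nlinarith)
    linarith
  have hderiv : ∀ θ ∈ Set.uIcc (0:ℝ) (π / 2),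
      HasDerivAt (fun θ => log (sin θ + √(sin θ ^ 2 + b))) (cos θ / √(sin θ ^ 2 + b)) θ := by
    intro θ _
    have hs := hasDerivAt_sin θ
    have hd : HasDerivAt (fun θ => sin θ ^ 2 + b) (2 * sin θ * cos θ) θ := by
      simpa using (hs.fun_pow 2).add_const b
    have hr := (sqrt_pos.2 (hpos θ)).ne'
    have hsr := (hsum θ).ne'
    have key : ∀ r : ℝ, r ≠ 0 → sin θ + r ≠ 0 →
        cos θ / r = (cos θ + 2 * sin θ * cos θ / (2 * r)) / (sin θ + r) := by
      intro r h1 h2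
      field_simp
      ring
    rw [key _ hr hsr]
    exact (hs.fun_add (hd.sqrt (hpos θ).ne')).log hsr
  have hcont : Continuous fun θ : ℝ => cos θ / √(sin θ ^ 2 + b) :=
    continuous_cos.div (by fun_prop) fun θ => (sqrt_pos.2 (hpos θ)).ne'
  rw [intervalIntegral.integral_eq_sub_of_hasDerivAt hderiv (hcont.intervalIntegrable _ _)]
  simp [log_sqrt hb.le]

open Real in
theorem abs_cos_two_mul_sub_cos_div_sqrt_le {b θ : ℝ} (hb : 0 < b) (hθ : 0 ≤ cos θ) :
    |cos (2 * θ) / √(sin θ ^ 2 + b) - cos θ / √(sin θ ^ 2 + b)| ≤ 3 := by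
  have hpos : 0 < √(sin θ ^ 2 + b) := sqrt_pos.2 (by positivity)
  have hc := cos_le_one θ
  have hsc := sin_sq_add_cos_sq θ
  have hsin : |sin θ| ≤ √(sin θ ^ 2 + b) := abs_le_sqrt (by linarith)
  have hle : sin θ ^ 2 ≤ √(sin θ ^ 2 + b) := by
    have h1 := abs_sin_le_one θ
    have h0 := abs_nonneg (sin θ)
    rw [← sq_abs]
    rw [← sq_abs] at hsin
    nlinarith
  rw [← sub_div, abs_div, abs_of_pos hpos, div_le_iff₀ hpos, cos_two_mul, abs_le]
  constructor <;> nlinarith [mul_nonneg hθ (sub_nonneg.2 hc)]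

open Real in
theorem abs_F_sub_le {s : ℝ} (hs : 0 < s) :
    |F s - (log (1 + √(1 + s / 4)) - log (s / 4) / 2)| ≤ 3 * (π / 2) := by
  have hb : 0 < s / 4 := by positivity
  have hne : ∀ θ : ℝ, √(sin θ ^ 2 + s / 4) ≠ 0 := fun θ => (sqrt_pos.2 (by positivity)).ne'
  have h1 : Continuous fun θ : ℝ => cos (2 * θ) / √(sin θ ^ 2 + s / 4) :=
    Continuous.div (by fun_prop) (by fun_prop) hne
  have h2 : Continuous fun θ : ℝ => cos θ / √(sin θ ^ 2 + s / 4) :=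
    Continuous.div (by fun_prop) (by fun_prop) hne
  rw [← integral_cos_div_sqrt_sin_sq_add hb, F,
    ← intervalIntegral.integral_sub (h1.intervalIntegrable _ _) (h2.intervalIntegrable _ _)]
  have hpi := pi_pos
  have h := intervalIntegral.norm_integral_le_of_norm_le_const (a := 0) (b := π / 2) (C := 3)
    (f := fun θ => cos (2 * θ) / √(sin θ ^ 2 + s / 4) - cos θ / √(sin θ ^ 2 + s / 4))
    fun θ hθ => by
      rw [Set.uIoc_of_le (by positivity)] at hθ
      exact abs_cos_two_mul_sub_cos_div_sqrt_le hb
        (cos_nonneg_of_mem_Icc ⟨by linarith [hθ.1], hθ.2⟩)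
  rwa [sub_zero, abs_of_pos (by positivity : 0 < π / 2)] at h

/-- For every `R₀ > 0` there exists `C₀ > 0` such that
`|F(s) + (1/2)·ln s| ≤ C₀` for all `s ∈ (0, R₀]`. -/
theorem stmt_0 :
    ∀ R₀ > (0:ℝ), ∃ C₀ > (0:ℝ), ∀ s ∈ Set.Ioc (0:ℝ) R₀,
      |F s + (1/2) * Real.log s| ≤ C₀ := by
  intro R₀ hR
  have hlog : ∀ x : ℝ, 0 ≤ Real.log (1 + √(1 + x / 4)) := fun x =>
    Real.log_nonneg (by linarith [Real.sqrt_nonneg (1 + x / 4)])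
  have h4 : 0 < Real.log 4 := Real.log_pos (by norm_num)
  have hpi := Real.pi_pos
  refine ⟨3 * (Real.pi / 2) + Real.log (1 + √(1 + R₀ / 4)) + Real.log 4 / 2,
    by linarith [hlog R₀], ?_⟩
  rintro s ⟨hs, hsR⟩
  have hmono : Real.log (1 + √(1 + s / 4)) ≤ Real.log (1 + √(1 + R₀ / 4)) :=
    Real.log_le_log (by positivity) (by gcongr)
  have h := abs_le.1 (abs_F_sub_le hs)
  rw [Real.log_div hs.ne' (by norm_num)] at h
  have hs0 := hlog s
  exact abs_le.2 ⟨by linarith [h.1], by linarith [h.2]⟩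
end

section
/- The function F is differentiable on (0, ∞), and for every R₀ > 0 there exists a constant C₀ > 0 such that for all s ∈ (0, R₀] one has |F′(s) + 1/(2s)| ≤ C₀·(1 + |ln s|). -/
open Real in
/-- Differentiation under the integral sign. -/
lemma hasDerivAt_F {s : ℝ} (hs : 0 < s) :
    HasDerivAt F (∫ θ in (0:ℝ)..(π / 2),
      -(cos (2 * θ) / (8 * ((sin θ ^ 2 + s / 4) * √(sin θ ^ 2 + s / 4))))) s := by
  have hball : ∀ x ∈ Metric.ball s (s / 2), s / 2 < x := by
    intro x hx
    rw [Metric.mem_ball, Real.dist_eq, abs_lt] at hx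
    linarith [hx.1]
  have hpos : ∀ x, 0 < x → ∀ θ : ℝ, 0 < sin θ ^ 2 + x / 4 := by
    intro x hx θ
    positivity
  have hcont : ∀ x, 0 < x →
      Continuous fun θ : ℝ => cos (2 * θ) / √(sin θ ^ 2 + x / 4) := by
    intro x hx
    refine Continuous.div (by fun_prop) (by fun_prop) fun θ => ?_
    exact (Real.sqrt_pos.2 (hpos x hx θ)).ne'
  have hcont' : Continuous fun θ : ℝ =>
      -(cos (2 * θ) / (8 * ((sin θ ^ 2 + s / 4) * √(sin θ ^ 2 + s / 4)))) := by
    refine (Continuous.div (by fun_prop) (by fun_prop) fun θ => ?_).neg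
    have h1 := hpos s hs θ
    positivity
  unfold F
  refine (intervalIntegral.hasDerivAt_integral_of_dominated_loc_of_deriv_le
    (μ := MeasureTheory.volume) (a := 0) (b := π / 2)
    (F := fun x θ => cos (2 * θ) / √(sin θ ^ 2 + x / 4))
    (F' := fun x θ => -(cos (2 * θ) / (8 * ((sin θ ^ 2 + x / 4) * √(sin θ ^ 2 + x / 4)))))
    (bound := fun _ => 1 / (8 * (s / 8 * √(s / 8))))
    (Metric.ball_mem_nhds s (half_pos hs)) ?_ ((hcont s hs).intervalIntegrable _ _)
    hcont'.aestronglyMeasurable ?_ intervalIntegrable_const ?_).2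
  · filter_upwards [Metric.ball_mem_nhds s (half_pos hs)] with x hx
    exact (hcont x (by linarith [hball x hx])).aestronglyMeasurable
  · refine Filter.Eventually.of_forall fun θ _ x hx => ?_
    have hx' := hball x hx
    have h1 : s / 8 ≤ sin θ ^ 2 + x / 4 := by nlinarith [sq_nonneg (sin θ)]
    have h0 : 0 < sin θ ^ 2 + x / 4 := by linarith
    rw [norm_neg, norm_div, Real.norm_eq_abs, Real.norm_eq_abs,
      abs_of_pos (by positivity : 0 < 8 * ((sin θ ^ 2 + x / 4) * √(sin θ ^ 2 + x / 4)))]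
    gcongr
    exact abs_cos_le_one _
  · refine Filter.Eventually.of_forall fun θ _ x hx => ?_
    have h0 := hpos x (by linarith [hball x hx]) θ
    have hd : HasDerivAt (fun y : ℝ => sin θ ^ 2 + y / 4) (1 / 4) x :=
      ((hasDerivAt_id x).div_const 4).const_add _
    have hr := Real.sqrt_pos.2 h0
    have h2 := ((hasDerivAt_const x (cos (2 * θ))).div (hd.sqrt h0.ne') hr.ne')
    refine h2.congr_deriv ?_
    rw [Real.sq_sqrt h0.le]
    field_simp
    ring

open Real in
lemma hasDerivAt_sqrt_sin_sq_add {a : ℝ} (ha : 0 < a) (θ : ℝ) :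
    HasDerivAt (fun θ => √(sin θ ^ 2 + a)) (sin θ * cos θ / √(sin θ ^ 2 + a)) θ := by
  have h0 : 0 < sin θ ^ 2 + a := by positivity
  have hq : HasDerivAt (fun θ => sin θ ^ 2 + a) (2 * sin θ * cos θ) θ := by
    simpa using ((hasDerivAt_sin θ).fun_pow 2).add_const a
  refine (hq.sqrt h0.ne').congr_deriv ?_
  field_simp

open Real in
/-- The leading part of the differentiated kernel has an explicit primitive. -/
lemma integral_cos_div_mul_sqrt {a : ℝ} (ha : 0 < a) :
    ∫ θ in (0:ℝ)..(π / 2), cos θ / ((sin θ ^ 2 + a) * √(sin θ ^ 2 + a)) =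
      1 / (a * √(1 + a)) := by
  have hpos : ∀ θ : ℝ, 0 < sin θ ^ 2 + a := fun θ => by positivity
  have hd : ∀ θ : ℝ, HasDerivAt (fun θ => sin θ / (a * √(sin θ ^ 2 + a)))
      (cos θ / ((sin θ ^ 2 + a) * √(sin θ ^ 2 + a))) θ := by
    intro θ
    have h0 := hpos θ
    have hr := Real.sqrt_pos.2 h0
    have hq := (hasDerivAt_sqrt_sin_sq_add ha θ).const_mul a
    have h := (hasDerivAt_sin θ).fun_div hq (by positivity)
    refine h.congr_deriv ?_
    have hs := Real.sq_sqrt h0.le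
    generalize √(sin θ ^ 2 + a) = r at *
    rw [← hs]
    field_simp
    have : a = r ^ 2 - sin θ ^ 2 := by linarith
    rw [this]
  rw [intervalIntegral.integral_eq_sub_of_hasDerivAt (fun θ _ => hd θ)]
  · simp
  · refine Continuous.intervalIntegrable (Continuous.div (by fun_prop) (by fun_prop) fun θ => ?_) _ _
    have := hpos θ
    positivity

open Real in
lemma integral_cos_div_sqrt {a : ℝ} (ha : 0 < a) :
    ∫ θ in (0:ℝ)..(π / 2), cos θ / √(sin θ ^ 2 + a) =
      log (1 + √(1 + a)) - log a / 2 := by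
  have hpos : ∀ θ : ℝ, 0 < sin θ ^ 2 + a := fun θ => by positivity
  have hlt : ∀ θ : ℝ, 0 < sin θ + √(sin θ ^ 2 + a) := by
    intro θ
    have : |sin θ| < √(sin θ ^ 2 + a) := by
      rw [← Real.sqrt_sq_eq_abs]
      exact Real.sqrt_lt_sqrt (sq_nonneg _) (by linarith)
    linarith [neg_abs_le (sin θ)]
  have hd : ∀ θ : ℝ, HasDerivAt (fun θ => log (sin θ + √(sin θ ^ 2 + a)))
      (cos θ / √(sin θ ^ 2 + a)) θ := by
    intro θ
    have h0 := hpos θ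
    have hr := Real.sqrt_pos.2 h0
    have h := ((hasDerivAt_sin θ).fun_add (hasDerivAt_sqrt_sin_sq_add ha θ)).log (hlt θ).ne'
    refine h.congr_deriv ?_
    have hl := hlt θ
    generalize √(sin θ ^ 2 + a) = r at *
    field_simp
    ring
  rw [intervalIntegral.integral_eq_sub_of_hasDerivAt (fun θ _ => hd θ)]
  · simp [Real.log_sqrt ha.le]
  · refine Continuous.intervalIntegrable (Continuous.div (by fun_prop) (by fun_prop) fun θ => ?_) _ _
    exact (Real.sqrt_pos.2 (hpos θ)).ne'

open Real in
/-- Pointwise control of the error made by replacing `cos (2θ)` with `cos θ`. -/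
lemma abs_cos_two_mul_sub_cos_div_le {a θ : ℝ} (ha : 0 < a) (hc : 0 ≤ cos θ) :
    |(cos (2 * θ) - cos θ) / ((sin θ ^ 2 + a) * √(sin θ ^ 2 + a))| ≤
      3 * (cos θ / √(sin θ ^ 2 + a) + 1) := by
  have h0 : 0 < sin θ ^ 2 + a := by positivity
  have hr := Real.sqrt_pos.2 h0
  have hc1 := cos_le_one θ
  have hsc := sin_sq_add_cos_sq θ
  have hnum : |cos (2 * θ) - cos θ| ≤ 3 * sin θ ^ 2 := by
    rw [cos_two_mul, abs_le]
    constructor <;> nlinarith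
  have hle : 1 - cos θ ≤ √(sin θ ^ 2 + a) := by
    apply Real.le_sqrt_of_sq_le
    nlinarith
  rw [abs_div, abs_of_pos (mul_pos h0 hr)]
  calc |cos (2 * θ) - cos θ| / ((sin θ ^ 2 + a) * √(sin θ ^ 2 + a))
      ≤ 3 * (sin θ ^ 2 + a) / ((sin θ ^ 2 + a) * √(sin θ ^ 2 + a)) := by
        gcongr
        linarith
    _ = 3 * (1 / √(sin θ ^ 2 + a)) := by field_simp
    _ ≤ 3 * (cos θ / √(sin θ ^ 2 + a) + 1) := by
        gcongr
        rw [div_add_one hr.ne']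
        gcongr
        linarith

open Real in
lemma abs_integral_cos_two_mul_sub_le {a : ℝ} (ha : 0 < a) :
    |(∫ θ in (0:ℝ)..(π / 2), cos (2 * θ) / ((sin θ ^ 2 + a) * √(sin θ ^ 2 + a))) - 1 / a| ≤
      1 / 2 + 3 * (√(1 + a) + |log a| / 2 + π / 2) := by
  have hpos : ∀ θ : ℝ, 0 < (sin θ ^ 2 + a) * √(sin θ ^ 2 + a) := fun θ => by positivity
  have hi : ∀ f : ℝ → ℝ, Continuous f → IntervalIntegrable
      (fun θ => f θ / ((sin θ ^ 2 + a) * √(sin θ ^ 2 + a))) MeasureTheory.volume 0 (π / 2) :=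
    fun f hf => (hf.div (by fun_prop) fun θ => (hpos θ).ne').intervalIntegrable _ _
  have hj : IntervalIntegrable (fun θ => cos θ / √(sin θ ^ 2 + a))
      MeasureTheory.volume 0 (π / 2) := by
    refine (continuous_cos.div (by fun_prop) fun θ => ?_).intervalIntegrable _ _
    have : 0 < sin θ ^ 2 + a := by positivity
    positivity
  have hsplit := intervalIntegral.integral_sub (hi (fun θ => cos (2 * θ)) (by fun_prop))
    (hi cos (by fun_prop))
  simp only [← sub_div] at hsplit
  rw [integral_cos_div_mul_sqrt ha] at hsplit
  have herr : |∫ θ in (0:ℝ)..(π / 2),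
      (cos (2 * θ) - cos θ) / ((sin θ ^ 2 + a) * √(sin θ ^ 2 + a))| ≤
      3 * (√(1 + a) + |log a| / 2 + π / 2) := by
    have h := intervalIntegral.norm_integral_le_of_norm_le (μ := MeasureTheory.volume)
      (f := fun θ => (cos (2 * θ) - cos θ) / ((sin θ ^ 2 + a) * √(sin θ ^ 2 + a)))
      (g := fun θ => 3 * (cos θ / √(sin θ ^ 2 + a) + 1)) (a := 0) (b := π / 2)
      (by positivity)
      (Filter.Eventually.of_forall fun θ hθ => abs_cos_two_mul_sub_cos_div_le ha
        (cos_nonneg_of_mem_Icc ⟨by linarith [hθ.1, pi_pos], hθ.2⟩))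
      ((hj.add intervalIntegrable_const).const_mul 3)
    rw [intervalIntegral.integral_const_mul,
      intervalIntegral.integral_add hj intervalIntegrable_const, integral_cos_div_sqrt ha,
      intervalIntegral.integral_const, Real.norm_eq_abs] at h
    refine h.trans ?_
    have h1 := Real.log_le_sub_one_of_pos (by positivity : 0 < 1 + √(1 + a))
    simp only [smul_eq_mul, mul_one, sub_zero]
    linarith [neg_abs_le (log a)]
  have hmain : |1 / (a * √(1 + a)) - 1 / a| ≤ 1 / 2 := by
    have hs := Real.sq_sqrt (by positivity : 0 ≤ 1 + a)
    have h1 : 1 ≤ √(1 + a) := Real.one_le_sqrt.2 (by linarith)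
    generalize √(1 + a) = r at *
    obtain rfl : a = r ^ 2 - 1 := by linarith
    have : 1 / ((r ^ 2 - 1) * r) - 1 / (r ^ 2 - 1) = -(1 / (r * (r + 1))) := by
      have hr : r - 1 ≠ 0 := by rintro h; nlinarith
      have : r ^ 2 - 1 = (r - 1) * (r + 1) := by ring
      rw [this]
      field_simp
      ring
    rw [this, abs_neg, abs_of_pos (by positivity)]
    gcongr
    nlinarith
  rw [abs_le] at *
  constructor <;> linarith [herr.1, herr.2, hmain.1, hmain.2]

/-- `F` is differentiable on `(0, ∞)`, and for every `R₀ > 0` there exists `C₀ > 0`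
such that `|F′(s) + 1/(2s)| ≤ C₀·(1 + |ln s|)` for all `s ∈ (0, R₀]`. -/
theorem stmt_1 :
    (∀ s ∈ Set.Ioi (0:ℝ), DifferentiableAt ℝ F s) ∧
    ∀ R₀ > (0:ℝ), ∃ C₀ > (0:ℝ), ∀ s ∈ Set.Ioc (0:ℝ) R₀,
      |deriv F s + 1/(2*s)| ≤ C₀ * (1 + |Real.log s|) := by
  refine ⟨fun s hs => (hasDerivAt_F hs).differentiableAt, fun R₀ hR₀ =>
    ⟨10 + R₀, by positivity, fun s hs => ?_⟩⟩
  have hs0 : 0 < s := hs.1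
  have ha : 0 < s / 4 := by positivity
  have hb := abs_integral_cos_two_mul_sub_le ha
  have hF : deriv F s = -(1 / 8) * ∫ θ in (0:ℝ)..(Real.pi / 2), Real.cos (2 * θ) /
      ((Real.sin θ ^ 2 + s / 4) * √(Real.sin θ ^ 2 + s / 4)) := by
    rw [(hasDerivAt_F hs0).deriv, ← intervalIntegral.integral_const_mul]
    refine intervalIntegral.integral_congr fun θ _ => ?_
    have : 0 < Real.sin θ ^ 2 + s / 4 := by positivity
    field_simp
  have hlog : |Real.log (s / 4)| ≤ |Real.log s| + 3 := by
    rw [Real.log_div hs0.ne' (by norm_num)]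
    have h4 := Real.log_le_sub_one_of_pos (by norm_num : (0:ℝ) < 4)
    have h4' : 0 ≤ Real.log 4 := Real.log_nonneg (by norm_num)
    refine (abs_sub _ _).trans ?_
    rw [abs_of_nonneg h4']
    linarith
  have hsqrt : √(1 + s / 4) ≤ 1 + R₀ := by
    rw [Real.sqrt_le_left (by positivity)]
    nlinarith [hs.2]
  have hsplit : deriv F s + 1 / (2 * s) = -(1 / 8) * ((∫ θ in (0:ℝ)..(Real.pi / 2),
      Real.cos (2 * θ) / ((Real.sin θ ^ 2 + s / 4) * √(Real.sin θ ^ 2 + s / 4))) -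
      1 / (s / 4)) := by
    rw [hF]
    have h8 : 1 / (s / 4) = 8 * (1 / (2 * s)) := by field_simp; norm_num
    rw [h8]
    ring
  rw [hsplit, abs_mul, abs_neg, abs_of_pos (by norm_num : (0:ℝ) < 1 / 8)]
  nlinarith [Real.pi_le_four, abs_nonneg (Real.log s), mul_nonneg hR₀.le (abs_nonneg (Real.log s))]
end

section
/- The function F is twice differentiable on (0, ∞), and for every R₀ > 0 there exists a constant C₀ > 0 such that for all s ∈ (0, R₀] one has s²·|F″(s)| ≤ C₀. -/
open MeasureTheory intervalIntegral

/-- The family of integrals obtained by differentiating `F` under the integral sign. -/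
noncomputable def profileMoment (p s : ℝ) : ℝ :=
  ∫ θ in (0:ℝ)..(Real.pi/2), Real.cos (2*θ) * (Real.sin θ ^ 2 + s/4) ^ p

lemma F_eq_profileMoment {s : ℝ} (hs : 0 < s) : F s = profileMoment (-(1/2)) s := by
  unfold F profileMoment
  congr 1
  ext θ
  have hq : 0 ≤ Real.sin θ ^ 2 + s/4 := by positivity
  rw [Real.rpow_neg hq, ← Real.sqrt_eq_rpow, div_eq_mul_inv]

lemma continuous_profileMoment_integrand (p : ℝ) {s : ℝ} (hs : 0 < s) :
    Continuous fun θ : ℝ => Real.cos (2*θ) * (Real.sin θ ^ 2 + s/4) ^ p := by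
  refine Continuous.mul (by fun_prop) (Continuous.rpow_const (by fun_prop) fun θ => Or.inl ?_)
  positivity

lemma hasDerivAt_profileMoment {p s : ℝ} (hp : p ≤ 0) (hs : 0 < s) :
    HasDerivAt (profileMoment p) (p/4 * profileMoment (p - 1) s) s := by
  have hball : ∀ x ∈ Metric.ball s (s/2), s/2 < x := by
    intro x hx
    rw [Metric.mem_ball, Real.dist_eq, abs_lt] at hx
    linarith
  have key := hasDerivAt_integral_of_dominated_loc_of_deriv_le (μ := volume) (𝕜 := ℝ)
    (a := 0) (b := Real.pi/2) (x₀ := s) (s := Metric.ball s (s/2))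
    (F := fun x θ => Real.cos (2*θ) * (Real.sin θ ^ 2 + x/4) ^ p)
    (F' := fun x θ => p/4 * (Real.cos (2*θ) * (Real.sin θ ^ 2 + x/4) ^ (p - 1)))
    (bound := fun _ => |p/4| * (s/8) ^ (p - 1))
    (Metric.ball_mem_nhds s (by positivity)) ?_
    ((continuous_profileMoment_integrand p hs).intervalIntegrable _ _)
    ((continuous_profileMoment_integrand (p - 1) hs).const_mul _).aestronglyMeasurable ?_
    (by simp) ?_
  · have h := key.2
    rw [intervalIntegral.integral_const_mul] at h
    exact h
  · filter_upwards [lt_mem_nhds hs] with x hx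
    exact (continuous_profileMoment_integrand p hx).aestronglyMeasurable
  · refine Filter.Eventually.of_forall fun θ _ x hx => ?_
    have hx := hball x hx
    have hq : s/8 ≤ Real.sin θ ^ 2 + x/4 := by nlinarith [sq_nonneg (Real.sin θ)]
    have h1 : (Real.sin θ ^ 2 + x/4) ^ (p - 1) ≤ (s/8) ^ (p - 1) :=
      Real.rpow_le_rpow_of_nonpos (by positivity) hq (by linarith)
    have h0 : 0 ≤ (Real.sin θ ^ 2 + x/4) ^ (p - 1) :=
      Real.rpow_nonneg (by linarith) _
    rw [Real.norm_eq_abs, abs_mul, abs_mul, abs_of_nonneg h0]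
    gcongr
    calc _ ≤ 1 * (Real.sin θ ^ 2 + x/4) ^ (p - 1) := by
            gcongr
            exact Real.abs_cos_le_one _
      _ ≤ _ := by simpa using h1
  · refine Filter.Eventually.of_forall fun θ _ x hx => ?_
    have hx := hball x hx
    have hq : Real.sin θ ^ 2 + x/4 ≠ 0 := by nlinarith [sq_nonneg (Real.sin θ)]
    have h := ((((hasDerivAt_id' x).div_const 4).const_add (Real.sin θ ^ 2)).rpow_const
      (p := p) (Or.inl hq)).const_mul (Real.cos (2*θ))
    exact h.congr_deriv (by ring)

lemma hasDerivAt_F_s2 {s : ℝ} (hs : 0 < s) :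
    HasDerivAt F (-(1/2)/4 * profileMoment (-(1/2) - 1) s) s := by
  refine (hasDerivAt_profileMoment (by norm_num) hs).congr_of_eventuallyEq ?_
  filter_upwards [lt_mem_nhds hs] with x hx
  exact F_eq_profileMoment hx

lemma hasDerivAt_deriv_F {s : ℝ} (hs : 0 < s) :
    HasDerivAt (deriv F) (3/64 * profileMoment (-(5/2)) s) s := by
  have h := (hasDerivAt_profileMoment (p := -(1/2) - 1) (by norm_num) hs).const_mul (-(1/2)/4 : ℝ)
  have h' : HasDerivAt (deriv F) _ s := h.congr_of_eventuallyEq (by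
    filter_upwards [lt_mem_nhds hs] with x hx
    exact (hasDerivAt_F_s2 hx).deriv)
  convert h' using 1
  norm_num
  ring

lemma integral_arctan_kernel_le (k : ℝ) :
    ∫ θ in (0:ℝ)..(Real.pi/2), k / (1 + (k*θ)^2) ≤ Real.pi/2 := by
  have h : ∀ θ ∈ Set.uIcc (0:ℝ) (Real.pi/2),
      HasDerivAt (fun θ => Real.arctan (k*θ)) (k / (1 + (k*θ)^2)) θ := by
    intro θ _
    exact ((hasDerivAt_id' θ).const_mul k).arctan.congr_deriv (by ring)
  rw [integral_eq_sub_of_hasDerivAt h]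
  · simpa using (Real.arctan_lt_pi_div_two _).le
  · refine Continuous.intervalIntegrable ?_ _ _
    exact continuous_const.div (by fun_prop) fun θ => by positivity

lemma rpow_neg_five_halves_le {a b q t : ℝ} (ha : 0 < a) (hb : 0 < b)
    (hq : (a*t)^2 + b^2 ≤ q) :
    b^4 * q ^ (-(5/2) : ℝ) ≤ 1/a * ((a/b) / (1 + (a/b*t)^2)) := by
  have hbq : b^2 ≤ q := by nlinarith [sq_nonneg (a*t)]
  have hq0 : 0 < q := lt_of_lt_of_le (by positivity) hbq
  have h1 : q ^ (-(5/2) : ℝ) = q ^ (-(3/2) : ℝ) * q⁻¹ := by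
    rw [← Real.rpow_neg_one q, ← Real.rpow_add hq0]
    norm_num
  have h2 : q ^ (-(3/2) : ℝ) ≤ (b^3)⁻¹ := by
    calc q ^ (-(3/2) : ℝ) ≤ (b^2) ^ (-(3/2) : ℝ) :=
          Real.rpow_le_rpow_of_nonpos (by positivity) hbq (by norm_num)
      _ = (b^3)⁻¹ := by
          rw [← Real.rpow_natCast b 2, ← Real.rpow_mul hb.le, ← Real.rpow_natCast b 3,
            ← Real.rpow_neg hb.le]
          norm_num
  have h3 : q⁻¹ ≤ ((a*t)^2 + b^2)⁻¹ := by gcongr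
  calc b^4 * q ^ (-(5/2) : ℝ) ≤ b^4 * ((b^3)⁻¹ * ((a*t)^2 + b^2)⁻¹) := by
        rw [h1]; gcongr
    _ = _ := by
        have : (a*t)^2 + b^2 ≠ 0 := by positivity
        have : 1 + (a/b*t)^2 ≠ 0 := by positivity
        field_simp
        ring

lemma sq_mul_abs_profileMoment_le {s : ℝ} (hs : 0 < s) :
    s^2 * |profileMoment (-(5/2)) s| ≤ 4 * Real.pi^2 := by
  have hpi := Real.pi_pos
  set b := Real.sqrt s / 2 with hb
  have hb0 : 0 < b := by positivity
  have hbs : b^2 = s/4 := by rw [hb, div_pow, Real.sq_sqrt hs.le]; norm_num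
  set a := 2/Real.pi with ha
  have ha0 : 0 < a := by positivity
  have hbound : ∀ θ ∈ Set.Ioc (0:ℝ) (Real.pi/2),
      ‖b^4 * (Real.cos (2*θ) * (Real.sin θ ^ 2 + s/4) ^ (-(5/2) : ℝ))‖
        ≤ 1/a * ((a/b) / (1 + (a/b*θ)^2)) := by
    intro θ hθ
    have hsin : a * θ ≤ Real.sin θ := Real.mul_le_sin hθ.1.le hθ.2
    have hsq : (a*θ)^2 ≤ Real.sin θ ^ 2 :=
      pow_le_pow_left₀ (mul_nonneg ha0.le hθ.1.le) hsin 2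
    have hr : 0 ≤ (Real.sin θ ^ 2 + s/4) ^ (-(5/2) : ℝ) := by positivity
    refine le_trans ?_ (rpow_neg_five_halves_le (q := Real.sin θ ^ 2 + s/4) ha0 hb0 (by linarith))
    rw [Real.norm_eq_abs, abs_mul, abs_mul, abs_of_nonneg hr, abs_of_pos (pow_pos hb0 4)]
    gcongr
    exact mul_le_of_le_one_left hr (Real.abs_cos_le_one _)
  have hcont : Continuous fun θ : ℝ => 1/a * ((a/b) / (1 + (a/b*θ)^2)) :=
    continuous_const.mul (continuous_const.div (by fun_prop) fun θ => by positivity)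
  have h := norm_integral_le_of_norm_le (μ := volume) (by positivity : (0:ℝ) ≤ Real.pi/2)
    (Filter.Eventually.of_forall hbound) (hcont.intervalIntegrable _ _)
  rw [intervalIntegral.integral_const_mul, intervalIntegral.integral_const_mul, Real.norm_eq_abs, abs_mul,
    abs_of_pos (pow_pos hb0 4)] at h
  have h4 : b^4 * |profileMoment (-(5/2)) s| ≤ 1/a * (Real.pi/2) :=
    h.trans (by gcongr; exact integral_arctan_kernel_le _)
  have hs2 : s^2 = 16 * b^4 := by rw [show b^4 = (b^2)^2 by ring, hbs]; ring
  have ha1 : 1/a * (Real.pi/2) = Real.pi^2/4 := by rw [ha]; field_simp; norm_num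
  rw [hs2, mul_assoc]
  linarith

/-- `F` is twice differentiable on `(0, ∞)`, and for every `R₀ > 0` there exists
`C₀ > 0` such that `s²·|F″(s)| ≤ C₀` for all `s ∈ (0, R₀]`. -/
theorem stmt_2 :
    (∀ s ∈ Set.Ioi (0:ℝ), DifferentiableAt ℝ F s ∧ DifferentiableAt ℝ (deriv F) s) ∧
    ∀ R₀ > (0:ℝ), ∃ C₀ > (0:ℝ), ∀ s ∈ Set.Ioc (0:ℝ) R₀,
      s^2 * |deriv (deriv F) s| ≤ C₀ := by
  refine ⟨fun s hs => ⟨(hasDerivAt_F_s2 hs).differentiableAt,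
    (hasDerivAt_deriv_F hs).differentiableAt⟩, fun R₀ _ =>
    ⟨3/64 * (4 * Real.pi^2), by positivity, fun s hs => ?_⟩⟩
  rw [(hasDerivAt_deriv_F hs.1).deriv, abs_mul, abs_of_pos (by norm_num : (0:ℝ) < 3/64)]
  linarith [sq_mul_abs_profileMoment_le hs.1]
end

section
/- Let M, γ > 0 with γ ≤ πM, and let f : ℝ² → ℝ be measurable with 0 ≤ f ≤ M almost everywhere and ∫_{ℝ²} f = γ. Then for every x ∈ ℝ², ∫_{B(x,1)} ln(1/|x − y|)·f(y) dy ≤ (γ/2)·ln(πM/γ) + γ/2. -/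
open MeasureTheory

/-- Layer cake bound for the truncated logarithmic potential of a disk. -/
lemma lintegral_posLog_div_dist_le {R : ℝ} (hR : 0 < R) (x : EuclideanSpace ℝ (Fin 2)) :
    ∫⁻ y, ENNReal.ofReal (Real.posLog (R / dist x y)) ≤ ENNReal.ofReal (Real.pi * R ^ 2 / 2) := by
  rw [lintegral_eq_lintegral_meas_lt]
  · calc
      _ ≤ ∫⁻ t in Set.Ioi (0 : ℝ), ENNReal.ofReal (Real.pi * R ^ 2 * Real.exp (-2 * t)) := by
        refine setLIntegral_mono' measurableSet_Ioi fun t ht => ?_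
        have ht : 0 < t := ht
        have hsub : {y : EuclideanSpace ℝ (Fin 2) | t < Real.posLog (R / dist x y)} ⊆
            Metric.ball x (R * Real.exp (-t)) := by
          intro y hy
          have hlog : t < Real.log (R / dist x y) := by
            simpa [Real.posLog, lt_max_iff, ht.not_gt] using hy
          rcases (dist_nonneg : 0 ≤ dist x y).eq_or_lt with h0 | hd
          · rw [← h0] at hlog
            simp at hlog
            linarith
          · have hexp := (Real.lt_log_iff_exp_lt (div_pos hR hd)).1 hlog
            rw [lt_div_iff₀ hd] at hexp
            rw [Metric.mem_ball, dist_comm, Real.exp_neg, ← div_eq_mul_inv,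
              lt_div_iff₀ (Real.exp_pos t)]
            linarith
        refine (measure_mono hsub).trans_eq ?_
        rw [EuclideanSpace.volume_ball_fin_two, ← ENNReal.ofReal_pow (by positivity),
          ← ENNReal.ofReal_mul (by positivity)]
        congr 1
        rw [mul_pow, ← Real.exp_nat_mul]
        push_cast
        ring_nf
      _ = ENNReal.ofReal (Real.pi * R ^ 2 / 2) := by
        rw [← ofReal_integral_eq_lintegral_ofReal
          ((integrableOn_exp_mul_Ioi (by norm_num) 0).const_mul _)
          (Filter.Eventually.of_forall fun t => by positivity),
          integral_const_mul, integral_exp_mul_Ioi (by norm_num)]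
        congr 1
        norm_num
        ring
  · exact Filter.Eventually.of_forall fun y => Real.posLog_nonneg
  · unfold Real.posLog
    fun_prop

lemma integrable_posLog_div_dist {R : ℝ} (hR : 0 < R) (x : EuclideanSpace ℝ (Fin 2)) :
    Integrable fun y => Real.posLog (R / dist x y) := by
  refine ⟨Measurable.aestronglyMeasurable (by unfold Real.posLog; fun_prop), ?_⟩
  rw [hasFiniteIntegral_iff_ofReal (Filter.Eventually.of_forall fun y => Real.posLog_nonneg)]
  exact (lintegral_posLog_div_dist_le hR x).trans_lt ENNReal.ofReal_lt_top

lemma integral_posLog_div_dist_le {R : ℝ} (hR : 0 < R) (x : EuclideanSpace ℝ (Fin 2)) :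
    ∫ y, Real.posLog (R / dist x y) ≤ Real.pi * R ^ 2 / 2 := by
  rw [← ENNReal.ofReal_le_ofReal_iff (by positivity), ofReal_integral_eq_lintegral_ofReal
    (integrable_posLog_div_dist hR x) (Filter.Eventually.of_forall fun y => Real.posLog_nonneg)]
  exact lintegral_posLog_div_dist_le hR x

/-- Let `M, γ > 0` with `γ ≤ πM` and let `f : ℝ² → ℝ` be measurable with
`0 ≤ f ≤ M` a.e. and `∫ f = γ`. Then for every `x ∈ ℝ²`,
`∫_{B(x,1)} ln(1/|x − y|)·f(y) dy ≤ (γ/2)·ln(πM/γ) + γ/2`. -/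
theorem stmt_6 (M γ : ℝ) (hM : 0 < M) (hγ : 0 < γ) (hγM : γ ≤ Real.pi * M)
    (f : EuclideanSpace ℝ (Fin 2) → ℝ) (hf_meas : Measurable f)
    (hf_nonneg : ∀ᵐ y, 0 ≤ f y) (hf_le : ∀ᵐ y, f y ≤ M)
    (hf_mass : (∫ y, f y) = γ)
    (x : EuclideanSpace ℝ (Fin 2)) :
    (∫ y in Metric.ball x 1, Real.log (1 / dist x y) * f y) ≤
      γ/2 * Real.log (Real.pi * M / γ) + γ/2 := by
  have hπM : 0 < Real.pi * M := by positivity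
  set R : ℝ := √(γ / (Real.pi * M)) with hR_def
  have hR : 0 < R := by positivity
  have hR_sq : R ^ 2 = γ / (Real.pi * M) := Real.sq_sqrt (by positivity)
  set L : ℝ := Real.log (Real.pi * M / γ) / 2 with hL_def
  have hL : 0 ≤ L := div_nonneg (Real.log_nonneg ((one_le_div hγ).2 hγM)) zero_le_two
  have hLR : Real.log R = -L := by
    rw [hR_def, Real.log_sqrt (by positivity), ← inv_div (Real.pi * M) γ, Real.log_inv, hL_def]
    ring
  have hf_int : Integrable f := by
    by_contra h
    rw [integral_undef h] at hf_mass
    exact hγ.ne hf_mass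
  have hφ := (integrable_posLog_div_dist hR x).const_mul M
  have hg : Integrable fun y => L * f y + M * Real.posLog (R / dist x y) :=
    (hf_int.const_mul L).add hφ
  calc
    _ ≤ ∫ y in Metric.ball x 1, (L * f y + M * Real.posLog (R / dist x y)) := by
      refine integral_mono_of_nonneg ?_ hg.integrableOn ?_
      · filter_upwards [ae_restrict_mem measurableSet_ball, ae_restrict_of_ae hf_nonneg]
          with y hy hy0
        rw [Metric.mem_ball, dist_comm] at hy
        refine mul_nonneg ?_ hy0
        rw [one_div, Real.log_inv]
        exact neg_nonneg.2 (Real.log_nonpos dist_nonneg hy.le)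
      · filter_upwards [ae_restrict_of_ae hf_nonneg, ae_restrict_of_ae hf_le] with y hy0 hyM
        have hpos : 0 ≤ Real.posLog (R / dist x y) := Real.posLog_nonneg
        rcases (dist_nonneg : 0 ≤ dist x y).eq_or_lt with h0 | hd
        · simp only [← h0, div_zero, Real.log_zero, zero_mul]
          rw [← h0, div_zero] at hpos
          positivity
        · have hlog : Real.log (1 / dist x y) = L + Real.log (R / dist x y) := by
            rw [one_div, Real.log_inv, Real.log_div hR.ne' hd.ne', hLR]
            ring
          have hle : Real.log (R / dist x y) ≤ Real.posLog (R / dist x y) := le_max_right _ _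
          rw [hlog, add_mul, mul_comm M]
          gcongr
    _ ≤ ∫ y, (L * f y + M * Real.posLog (R / dist x y)) := by
      refine setIntegral_le_integral hg ?_
      filter_upwards [hf_nonneg] with y hy0
      exact add_nonneg (mul_nonneg hL hy0) (mul_nonneg hM.le Real.posLog_nonneg)
    _ = L * γ + M * ∫ y, Real.posLog (R / dist x y) := by
      rw [integral_add (hf_int.const_mul L) hφ, integral_const_mul, integral_const_mul, hf_mass]
    _ ≤ L * γ + M * (Real.pi * R ^ 2 / 2) := by
      gcongr
      exact integral_posLog_div_dist_le hR x
    _ = γ/2 * Real.log (Real.pi * M / γ) + γ/2 := by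
      rw [hR_sq, hL_def]
      field_simp
end

section
/- Fix r* > 0, γ > 0 and M₀ > 0. There exist ε₀ ∈ (0, min(r*/4, 1/2)] and C > 0 such that for every ε ∈ (0, ε₀], every point X₀ = (z₀, r₀) ∈ ℝ × [r*/2, 2r*], and every measurable ω₀ : ℝ²₊ → ℝ with 0 ≤ ω₀ ≤ M₀/ε², support of ω₀ contained in the ball B(X₀, ε), and ∫_{ℝ²₊} x_r·ω₀(x) dx = γ, one has |E(ω₀) − (γ²/(2π))·|ln ε|·b_r| ≤ C, where b_r = (1/γ)·∫_{ℝ²₊} x_r²·ω₀(x) dx and E(ω₀) = −∬_{ℝ²₊×ℝ²₊} G(x, y)·x_r·ω₀(x)·y_r·ω₀(y) dx dy. -/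
open MeasureTheory

/-- The Green kernel `G(x, y) = −(1/(2π))·√(x_r·y_r)·F(|x − y|²/(x_r·y_r))` on the
half-plane, where a point `x ∈ ℝ²` is written `x = (x 0, x 1) = (x_z, x_r)`. -/
noncomputable def Gker (x y : EuclideanSpace ℝ (Fin 2)) : ℝ :=
  -(1/(2*Real.pi)) * Real.sqrt (x 1 * y 1) * F (‖x - y‖^2 / (x 1 * y 1))

/-- The open half-plane `ℝ²₊ = {x | x_r > 0}`. -/
def halfPlane : Set (EuclideanSpace ℝ (Fin 2)) := {x | 0 < x 1}

open Set

/-- The profile `F` has the logarithmic singularity of `-log b` at `s = 4 b ^ 2 → 0`. -/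
lemma abs_F_add_log_le {b : ℝ} (hb : 0 < b) (hb1 : b ≤ 1) :
    |F (4 * b ^ 2) + Real.log b| ≤ 3 * (Real.pi / 2) + 2 := by
  have hpos : ∀ θ : ℝ, 0 < Real.sin θ ^ 2 + b ^ 2 := fun θ ↦ by positivity
  have hsq : ∀ θ : ℝ, 0 < √(Real.sin θ ^ 2 + b ^ 2) := fun θ ↦ Real.sqrt_pos.2 (hpos θ)
  have hc1 : Continuous fun θ : ℝ ↦ Real.cos (2 * θ) / √(Real.sin θ ^ 2 + b ^ 2) := by
    refine Continuous.div (by fun_prop) (by fun_prop) fun θ ↦ (hsq θ).ne'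
  have hc2 : Continuous fun θ : ℝ ↦ Real.cos θ / √(Real.sin θ ^ 2 + b ^ 2) := by
    refine Continuous.div (by fun_prop) (by fun_prop) fun θ ↦ (hsq θ).ne'
  have hF : F (4 * b ^ 2) = ∫ θ in (0:ℝ)..(Real.pi/2),
      Real.cos (2 * θ) / √(Real.sin θ ^ 2 + b ^ 2) := by
    simp only [F, mul_div_cancel_left₀ (b ^ 2) (four_ne_zero' ℝ)]
  have hI : ∫ θ in (0:ℝ)..(Real.pi/2), Real.cos θ / √(Real.sin θ ^ 2 + b ^ 2)
      = Real.arsinh (1 / b) := by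
    rw [intervalIntegral.integral_eq_sub_of_hasDerivAt
      (f := fun θ ↦ Real.arsinh (Real.sin θ / b)) _ (hc2.intervalIntegrable _ _)]
    · simp
    · intro θ _
      refine ((Real.hasDerivAt_sin θ).div_const b).arsinh.congr_deriv ?_
      have : √(Real.sin θ ^ 2 + b ^ 2) = b * √(1 + (Real.sin θ / b) ^ 2) := by
        rw [← Real.sqrt_sq hb.le, ← Real.sqrt_mul (sq_nonneg b), Real.sqrt_sq hb.le]
        congr 1
        field_simp
        ring
      rw [this, smul_eq_mul]
      field_simp
  have hdiff : |F (4 * b ^ 2) - Real.arsinh (1 / b)| ≤ 3 * (Real.pi / 2) := by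
    rw [hF, ← hI, ← intervalIntegral.integral_sub (hc1.intervalIntegrable _ _)
      (hc2.intervalIntegrable _ _)]
    have := intervalIntegral.norm_integral_le_of_norm_le_const (a := 0) (b := Real.pi / 2) (C := 3)
      (f := fun θ ↦ Real.cos (2 * θ) / √(Real.sin θ ^ 2 + b ^ 2)
        - Real.cos θ / √(Real.sin θ ^ 2 + b ^ 2)) ?_
    · rwa [sub_zero, abs_of_pos (by positivity : 0 < Real.pi / 2), Real.norm_eq_abs] at this
    · intro θ hθ
      rw [uIoc_of_le (by positivity)] at hθ
      have hs0 : 0 ≤ Real.sin θ :=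
        Real.sin_nonneg_of_nonneg_of_le_pi hθ.1.le (by linarith [hθ.2, Real.pi_pos])
      have hco0 : 0 ≤ Real.cos θ := Real.cos_nonneg_of_neg_pi_div_two_le_of_le
        (by linarith [hθ.1, Real.pi_pos]) hθ.2
      have hs1 := Real.sin_le_one θ
      have hco1 := Real.cos_le_one θ
      have hsc := Real.sin_sq_add_cos_sq θ
      rw [← sub_div, Real.norm_eq_abs, abs_div, abs_of_pos (hsq θ), div_le_iff₀ (hsq θ)]
      have h1 : Real.sin θ ≤ √(Real.sin θ ^ 2 + b ^ 2) :=
        Real.le_sqrt_of_sq_le (by nlinarith)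
      have h2 : |Real.cos (2 * θ) - Real.cos θ| ≤ 3 * Real.sin θ := by
        rw [Real.cos_two_mul, abs_le]
        constructor <;> nlinarith [mul_nonneg hco0 (sub_nonneg.2 hco1),
          mul_nonneg hs0 (sub_nonneg.2 hs1)]
      linarith
  have hlog : |Real.arsinh (1 / b) + Real.log b| ≤ 2 := by
    have hinv : 1 ≤ 1 / b := (one_le_div hb).2 hb1
    have hr1 : 1 ≤ √(1 + (1 / b) ^ 2) := Real.one_le_sqrt.2 (by nlinarith)
    have hr2 : √(1 + (1 / b) ^ 2) ≤ 2 * (1 / b) :=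
      Real.sqrt_le_left (by positivity) |>.2 (by nlinarith)
    have hp : 0 < 1 / b + √(1 + (1 / b) ^ 2) := by positivity
    rw [Real.arsinh, ← Real.log_mul hp.ne' hb.ne', abs_of_nonneg]
    · have : (1 / b + √(1 + (1 / b) ^ 2)) * b ≤ 3 := by
        rw [← le_div_iff₀ hb]
        calc _ ≤ 3 * (1 / b) := by linarith
          _ = 3 / b := by ring
      linarith [Real.log_le_sub_one_of_pos (mul_pos hp hb)]
    · apply Real.log_nonneg
      rw [← div_le_iff₀ hb]
      linarith
  calc _ = |(F (4 * b ^ 2) - Real.arsinh (1 / b)) + (Real.arsinh (1 / b) + Real.log b)| := by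
        ring_nf
    _ ≤ _ := (abs_add_le _ _).trans (add_le_add hdiff hlog)

lemma measurable_F : Measurable F := by
  have h : F = fun s ↦ ∫ θ in Ioc (0:ℝ) (Real.pi / 2),
      Real.cos (2 * θ) / √(Real.sin θ ^ 2 + s / 4) := by
    ext s
    rw [F, intervalIntegral.integral_of_le (by positivity)]
  rw [h]
  refine (StronglyMeasurable.integral_prod_right ?_).measurable
  refine Measurable.stronglyMeasurable ?_
  simp only [Function.uncurry_def]
  fun_prop

lemma abs_log_le_of_mem_Icc {m R t : ℝ} (hm : 0 < m) (ht : t ∈ Icc m R) :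
    |Real.log t| ≤ |Real.log m| + |Real.log R| := by
  have h1 := Real.log_le_log hm ht.1
  have h2 := Real.log_le_log (hm.trans_le ht.1) ht.2
  rw [abs_le]
  constructor
  · linarith [neg_abs_le (Real.log m), abs_nonneg (Real.log R)]
  · linarith [le_abs_self (Real.log R), abs_nonneg (Real.log m)]

lemma abs_log_le_add_inv {t : ℝ} (ht : 0 < t) : |Real.log t| ≤ t + t⁻¹ := by
  have h1 := Real.log_le_sub_one_of_pos ht
  have h2 := Real.log_le_sub_one_of_pos (inv_pos.2 ht)
  rw [Real.log_inv] at h2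
  have := inv_pos.2 ht
  rw [abs_le]
  constructor <;> linarith

/-- Leading-order expansion of the profile part of the Green kernel at scale `ε`. -/
lemma abs_sqrt_mul_F_sub_le {m R ε p q d : ℝ} (hm : 0 < m) (hε : 0 < ε) (hε1 : ε ≤ 1)
    (hp : p ∈ Icc m R) (hq : q ∈ Icc m R) (hd : 0 < d) (hdε : d ≤ 2 * ε) (hdm : d ≤ 2 * m)
    (hpq : |p - q| ≤ d) :
    |√(p * q) * F (d ^ 2 / (p * q)) - |Real.log ε| * p| ≤
      R * (3 * (Real.pi / 2) + 5 + |Real.log m| + |Real.log R|) + 2 + R * (ε / d) := by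
  have hp0 := hm.trans_le hp.1
  have hq0 := hm.trans_le hq.1
  set g := √(p * q) with hg
  have hgg : g ^ 2 = p * q := Real.sq_sqrt (by positivity)
  have hgm : m ≤ g := Real.le_sqrt_of_sq_le (by nlinarith [hp.1, hq.1])
  have hR : 0 ≤ R := hp0.le.trans hp.2
  have hgR : g ≤ R := Real.sqrt_le_left hR |>.2 (by nlinarith [hp.2, hq.2])
  have hg0 := hm.trans_le hgm
  set b := d / (2 * g) with hb
  have hb0 : 0 < b := by positivity
  have hb1 : b ≤ 1 := (div_le_one (by positivity)).2 (by linarith)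
  have hs : d ^ 2 / (p * q) = 4 * b ^ 2 := by
    rw [← hgg, hb]; field_simp; norm_num
  have hF := abs_F_add_log_le hb0 hb1
  have hlb : Real.log b = Real.log ε - Real.log (ε / d) - Real.log 2 - Real.log g := by
    rw [hb, Real.log_div hd.ne' (by positivity), Real.log_mul two_ne_zero hg0.ne',
      Real.log_div hε.ne' hd.ne']
    ring
  have hl2 : |Real.log 2| ≤ 1 := by
    rw [abs_of_pos (Real.log_pos one_lt_two)]
    linarith [Real.log_le_sub_one_of_pos (zero_lt_two' ℝ)]
  have hlg := abs_log_le_of_mem_Icc hm (⟨hgm, hgR⟩ : g ∈ Icc m R)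
  have hld : |Real.log (ε / d)| ≤ ε / d + 2 := by
    refine (abs_log_le_add_inv (div_pos hε hd)).trans ?_
    rw [inv_div]
    gcongr
    rwa [div_le_iff₀ hε]
  have hlε : |Real.log ε| = -Real.log ε := abs_of_nonpos (Real.log_nonpos hε.le hε1)
  have hA : |F (d ^ 2 / (p * q)) - (|Real.log ε|)| ≤
      3 * (Real.pi / 2) + 5 + |Real.log m| + |Real.log R| + ε / d := by
    rw [hs, hlε]
    rw [hlb] at hF
    rw [abs_le] at hF hl2 hlg hld ⊢
    constructor <;> linarith [hF.1, hF.2, hl2.1, hl2.2, hlg.1, hlg.2, hld.1, hld.2]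
  have hgp : |g - p| ≤ d := by
    rw [abs_le] at hpq ⊢
    rcases le_total p q with h | h
    · have h1 : p ≤ g := Real.le_sqrt_of_sq_le (by nlinarith)
      have h2 : g ≤ q := Real.sqrt_le_left hq0.le |>.2 (by nlinarith)
      constructor <;> linarith [hpq.1]
    · have h1 : q ≤ g := Real.le_sqrt_of_sq_le (by nlinarith)
      have h2 : g ≤ p := Real.sqrt_le_left hp0.le |>.2 (by nlinarith)
      constructor <;> linarith [hpq.2]
  have hεl : ε * |Real.log ε| ≤ 1 := by
    have := (Real.abs_log_mul_self_lt ε hε hε1).le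
    rwa [abs_mul, abs_of_pos hε, mul_comm] at this
  calc _ = |g * (F (d ^ 2 / (p * q)) - |Real.log ε|) + (g - p) * (|Real.log ε|)| := by ring_nf
    _ ≤ g * |F (d ^ 2 / (p * q)) - (|Real.log ε|)| + |g - p| * (|Real.log ε|) := by
        refine (abs_add_le _ _).trans (le_of_eq ?_)
        rw [abs_mul, abs_mul, abs_abs, abs_of_pos hg0]
    _ ≤ R * (3 * (Real.pi / 2) + 5 + |Real.log m| + |Real.log R| + ε / d)
          + 2 * ε * |Real.log ε| := by
        gcongr
        exact hgp.trans hdε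
    _ ≤ _ := by linarith

/-- The truncated kernel `1 / ‖u‖` is integrable in the plane, with integral `O(r)`. -/
lemma integrable_truncated_inv_norm {r : ℝ} (hr : 0 < r) :
    Integrable (fun u : EuclideanSpace ℝ (Fin 2) ↦ (Iio r).indicator (fun t ↦ t⁻¹) ‖u‖) ∧
    ∫ u : EuclideanSpace ℝ (Fin 2), (Iio r).indicator (fun t ↦ t⁻¹) ‖u‖
      = 2 * volume.real (Metric.ball (0 : EuclideanSpace ℝ (Fin 2)) 1) * r := by
  have h : EqOn (fun t : ℝ ↦ t ^ (2 - 1) • (Iio r).indicator (fun t ↦ t⁻¹) t)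
      ((Iio r).indicator fun _ ↦ 1) (Ioi 0) := by
    intro t ht
    have ht0 : t ≠ 0 := (mem_Ioi.1 ht).ne'
    by_cases htr : t < r <;> simp [htr, ht0]
  constructor
  · rw [integrable_fun_norm_addHaar, finrank_euclideanSpace_fin,
      integrableOn_congr_fun h measurableSet_Ioi, IntegrableOn,
      integrable_indicator_iff measurableSet_Iio, IntegrableOn,
      Measure.restrict_restrict measurableSet_Iio]
    refine integrableOn_const ?_
    rw [Iio_inter_Ioi]
    simp
  · rw [integral_fun_norm_addHaar, finrank_euclideanSpace_fin,
      setIntegral_congr_fun measurableSet_Ioi h, setIntegral_indicator measurableSet_Iio,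
      Ioi_inter_Iio]
    simp [hr.le]
    ring

/-- If each section of a kernel integrates against `ρ` to `L` up to an error `C`, then so does the
double integral, up to an error `C * ∫ ρ`. -/
lemma abs_integral_integral_sub_le {α : Type*} [MeasurableSpace α] {μ : Measure α} [SFinite μ]
    {ρ L : α → ℝ} {K : α → α → ℝ} {C : ℝ} (hρ : Integrable ρ μ) (hρm : Measurable ρ)
    (hρ0 : ∀ x, 0 ≤ ρ x)
    (hK : Measurable (Function.uncurry K)) (hL : Integrable (fun x ↦ L x * ρ x) μ)
    (h : ∀ x, ρ x ≠ 0 → |(∫ y, K x y * ρ y ∂μ) - L x| ≤ C) :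
    |(∫ x, ∫ y, K x y * ρ x * ρ y ∂μ ∂μ) - ∫ x, L x * ρ x ∂μ| ≤ C * ∫ x, ρ x ∂μ := by
  have heq : ∀ x, ∫ y, K x y * ρ x * ρ y ∂μ = (∫ y, K x y * ρ y ∂μ) * ρ x := fun x ↦ by
    rw [← integral_mul_const]
    congr with y
    ring
  have hbd : ∀ x, ‖(∫ y, K x y * ρ y ∂μ) * ρ x - L x * ρ x‖ ≤ C * ρ x := fun x ↦ by
    rw [← sub_mul, Real.norm_eq_abs, abs_mul, abs_of_nonneg (hρ0 x)]
    by_cases hx : ρ x = 0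
    · simp [hx]
    · exact mul_le_mul_of_nonneg_right (h x hx) (hρ0 x)
  have hm : StronglyMeasurable fun x ↦ ∫ y, K x y * ρ y ∂μ := by
    refine StronglyMeasurable.integral_prod_right (Measurable.stronglyMeasurable ?_)
    exact hK.mul (hρm.comp measurable_snd)
  have hd : Integrable (fun x ↦ (∫ y, K x y * ρ y ∂μ) * ρ x - L x * ρ x) μ :=
    (hρ.const_mul C).mono' ((hm.aestronglyMeasurable.mul hρ.1).sub hL.1)
      (Filter.Eventually.of_forall hbd)
  have hi : Integrable (fun x ↦ (∫ y, K x y * ρ y ∂μ) * ρ x) μ := by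
    exact (hd.add hL).congr (Filter.Eventually.of_forall fun x ↦ sub_add_cancel _ _)
  simp only [heq]
  rw [← integral_sub hi hL, ← integral_const_mul]
  exact norm_integral_le_of_norm_le (hρ.const_mul C) (Filter.Eventually.of_forall hbd)

/-- Expansion of the energy of a sharply concentrated vortex ring: there exist
`ε₀ ∈ (0, min(r*/4, 1/2)]` and `C > 0` such that for every `ε ∈ (0, ε₀]`, every
admissible concentrated blob `ω₀` of circulation `γ` around `X₀` with
`r*/2 ≤ X₀_r ≤ 2r*` satisfies `|E(ω₀) − (γ²/(2π))·|ln ε|·b_r| ≤ C`. -/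
theorem stmt_7 (rstar γ M₀ : ℝ) (hr : 0 < rstar) (hγ : 0 < γ) (hM : 0 < M₀) :
    ∃ ε₀ ∈ Set.Ioc (0:ℝ) (min (rstar/4) (1/2)), ∃ C > (0:ℝ),
      ∀ ε ∈ Set.Ioc (0:ℝ) ε₀, ∀ X₀ : EuclideanSpace ℝ (Fin 2),
        X₀ 1 ∈ Set.Icc (rstar/2) (2*rstar) →
        ∀ ω₀ : EuclideanSpace ℝ (Fin 2) → ℝ, Measurable ω₀ →
          (∀ x, 0 ≤ ω₀ x ∧ ω₀ x ≤ M₀ / ε^2) →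
          Function.support ω₀ ⊆ Metric.ball X₀ ε →
          (∫ x in halfPlane, x 1 * ω₀ x) = γ →
          |(-(∫ x in halfPlane, ∫ y in halfPlane,
                Gker x y * (x 1 * ω₀ x) * (y 1 * ω₀ y)))
            - γ^2/(2*Real.pi) * |Real.log ε| *
                ((1/γ) * ∫ x in halfPlane, (x 1)^2 * ω₀ x)| ≤ C := by
  obtain ⟨m, hm⟩ : ∃ m, m = rstar / 4 := ⟨_, rfl⟩
  obtain ⟨R, hR⟩ : ∃ R, R = 9 * rstar / 4 := ⟨_, rfl⟩
  have hm0 : 0 < m := by linarith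
  have hR0 : 0 < R := by linarith
  have hπ := Real.pi_pos
  obtain ⟨A, hA⟩ : ∃ A, A = R * (3 * (Real.pi / 2) + 5 + |Real.log m| + |Real.log R|) + 2 :=
    ⟨_, rfl⟩
  have hA0 : 0 < A := by rw [hA]; positivity
  obtain ⟨v, hv⟩ : ∃ v, v = volume.real (Metric.ball (0 : EuclideanSpace ℝ (Fin 2)) 1) := ⟨_, rfl⟩
  have hv0 : 0 ≤ v := hv ▸ measureReal_nonneg
  refine ⟨min (rstar / 4) (1 / 2), ⟨by positivity, le_rfl⟩,
    1 / (2 * Real.pi) * ((A * γ + 4 * R ^ 2 * M₀ * v) * γ), by positivity, ?_⟩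
  intro ε ⟨hε, hε₀⟩ X₀ ⟨hX1, hX2⟩ ω hω hωb hsupp hmass
  have hεm : ε ≤ m := hm ▸ hε₀.trans (min_le_left _ _)
  have hε1 : ε ≤ 1 := by linarith [hε₀.trans (min_le_right (rstar / 4) (1 / 2))]
  have hball : ∀ x, ω x ≠ 0 → x 1 ∈ Icc m R ∧ ‖x - X₀‖ < ε := by
    intro x hx
    have hxb : ‖x - X₀‖ < ε := by simpa [dist_eq_norm] using hsupp hx
    have h1 : |x 1 - X₀ 1| ≤ ‖x - X₀‖ := by simpa using PiLp.norm_apply_le (x - X₀) 1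
    rw [abs_le] at h1
    exact ⟨⟨by linarith [h1.1], by linarith [h1.2]⟩, hxb⟩
  obtain ⟨ρ, hρ⟩ : ∃ ρ : EuclideanSpace ℝ (Fin 2) → ℝ, ρ = fun x ↦ x 1 * ω x := ⟨_, rfl⟩
  have hρω : ∀ x, ρ x ≠ 0 → ω x ≠ 0 := fun x hx h ↦ hx (by simp [hρ, h])
  have hρ0 : ∀ x, 0 ≤ ρ x := fun x ↦ by
    by_cases hx : ω x = 0
    · simp [hρ, hx]
    · simpa [hρ] using mul_nonneg (hm0.le.trans (hball x hx).1.1) (hωb x).1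
  have hρle : ∀ x, ρ x ≤ R * (M₀ / ε ^ 2) := fun x ↦ by
    by_cases hx : ω x = 0
    · simp only [hρ, hx, mul_zero]; positivity
    · simpa [hρ] using mul_le_mul (hball x hx).1.2 (hωb x).2 (hωb x).1 hR0.le
  have hρm : Measurable ρ := by rw [hρ]; fun_prop
  have hmass' : ∫ x in halfPlane, ρ x = γ := by rw [hρ]; exact hmass
  have hρi : IntegrableOn ρ halfPlane := by
    by_contra h
    rw [integral_undef h] at hmass'
    exact hγ.ne hmass'
  obtain ⟨K, hK⟩ : ∃ K : EuclideanSpace ℝ (Fin 2) → EuclideanSpace ℝ (Fin 2) → ℝ,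
      K = fun x y ↦ √(x 1 * y 1) * F (‖x - y‖ ^ 2 / (x 1 * y 1)) := ⟨_, rfl⟩
  have hKm : Measurable (Function.uncurry K) := by
    have := measurable_F
    simp only [hK, Function.uncurry_def]
    fun_prop
  have hLi : IntegrableOn (fun x ↦ |Real.log ε| * x 1 * γ * ρ x) halfPlane := by
    refine (hρi.const_mul (|Real.log ε| * R * γ)).mono' (by fun_prop)
      (Filter.Eventually.of_forall fun x ↦ ?_)
    by_cases hx : ρ x = 0
    · simp [hx]
    · have hx1 := (hball x (hρω x hx)).1
      have hx0 : 0 ≤ x 1 := hm0.le.trans hx1.1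
      rw [Real.norm_of_nonneg (by have := hρ0 x; positivity)]
      gcongr
      · exact hρ0 x
      · exact hx1.2
  have hsection : ∀ x, ρ x ≠ 0 →
      |(∫ y in halfPlane, K x y * ρ y) - |Real.log ε| * x 1 * γ| ≤
        A * γ + 4 * R ^ 2 * M₀ * v := by
    intro x hx
    have hxb := hball x (hρω x hx)
    obtain ⟨hgi, hgv⟩ := integrable_truncated_inv_norm (r := 2 * ε) (by positivity)
    set g : EuclideanSpace ℝ (Fin 2) → ℝ := fun u ↦ (Iio (2 * ε)).indicator (fun t ↦ t⁻¹) ‖u‖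
    have hg0 : ∀ u, 0 ≤ g u := fun u ↦
      indicator_apply_nonneg fun _ ↦ inv_nonneg.2 (norm_nonneg u)
    have hgxi : Integrable fun y ↦ g (x - y) := hgi.comp_sub_left x
    have hgxv : ∫ y in halfPlane, g (x - y) ≤ 2 * v * (2 * ε) := by
      rw [hv, ← hgv, ← integral_sub_left_eq_self g volume x]
      exact setIntegral_le_integral hgxi (Filter.Eventually.of_forall fun y ↦ hg0 _)
    have hdom : Integrable (fun y ↦ A * ρ y + R * ε * (R * (M₀ / ε ^ 2)) * g (x - y))
        (volume.restrict halfPlane) := (hρi.const_mul A).add (hgxi.integrableOn.const_mul _)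
    have hbd : ∀ᵐ y ∂(volume.restrict halfPlane),
        ‖K x y * ρ y - |Real.log ε| * x 1 * ρ y‖ ≤
          A * ρ y + R * ε * (R * (M₀ / ε ^ 2)) * g (x - y) := by
      have hne : ∀ᵐ y ∂(volume.restrict halfPlane), y ≠ x := Measure.ae_ne _ x
      filter_upwards [hne] with y hyx
      by_cases hy : ρ y = 0
      · have := hg0 (x - y)
        simp only [hy, mul_zero, sub_zero, norm_zero, zero_add]
        positivity
      have hyb := hball y (hρω y hy)
      have hd0 : 0 < ‖x - y‖ := norm_pos_iff.2 (sub_ne_zero.2 hyx.symm)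
      have hd2 : ‖x - y‖ < 2 * ε := by
        have := norm_sub_le_norm_sub_add_norm_sub x X₀ y
        rw [norm_sub_rev X₀ y] at this
        linarith [hxb.2, hyb.2]
      have hpq : |x 1 - y 1| ≤ ‖x - y‖ := by simpa using PiLp.norm_apply_le (x - y) 1
      have hker := abs_sqrt_mul_F_sub_le hm0 hε hε1 hxb.1 hyb.1 hd0 hd2.le (by linarith) hpq
      have hgy : g (x - y) = ‖x - y‖⁻¹ := indicator_of_mem (mem_Iio.2 hd2) _
      rw [← sub_mul, Real.norm_eq_abs, abs_mul, abs_of_nonneg (hρ0 y), hgy]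
      calc _ ≤ (A + R * (ε / ‖x - y‖)) * ρ y := by
            refine mul_le_mul_of_nonneg_right ?_ (hρ0 y)
            rw [hA, hK]
            exact hker
        _ = A * ρ y + R * (ε / ‖x - y‖) * ρ y := add_mul _ _ _
        _ ≤ A * ρ y + R * (ε / ‖x - y‖) * (R * (M₀ / ε ^ 2)) := by
            gcongr
            exact hρle y
        _ = _ := by ring
    have hcm : Integrable (fun y ↦ |Real.log ε| * x 1 * ρ y) (volume.restrict halfPlane) :=
      hρi.const_mul _
    have hKx : Measurable fun y ↦ K x y := hKm.comp measurable_prodMk_left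
    have hdi : Integrable (fun y ↦ K x y * ρ y - |Real.log ε| * x 1 * ρ y)
        (volume.restrict halfPlane) :=
      hdom.mono' ((hKx.mul hρm).aestronglyMeasurable.sub hcm.1) hbd
    have hKi : Integrable (fun y ↦ K x y * ρ y) (volume.restrict halfPlane) :=
      (hdi.add hcm).congr (Filter.Eventually.of_forall fun y ↦ sub_add_cancel _ _)
    have hsub : (∫ y in halfPlane, K x y * ρ y) - |Real.log ε| * x 1 * γ =
        ∫ y in halfPlane, (K x y * ρ y - |Real.log ε| * x 1 * ρ y) := by
      rw [integral_sub hKi hcm, integral_const_mul, hmass']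
    rw [hsub]
    refine (norm_integral_le_of_norm_le hdom hbd).trans ?_
    rw [integral_add (hρi.const_mul A) (hgxi.integrableOn.const_mul _), integral_const_mul,
      integral_const_mul, hmass']
    refine add_le_add le_rfl ?_
    calc _ ≤ R * ε * (R * (M₀ / ε ^ 2)) * (2 * v * (2 * ε)) := by gcongr
      _ = 4 * R ^ 2 * M₀ * v := by field_simp; ring
  have hmain := abs_integral_integral_sub_le hρi hρm hρ0 hKm hLi hsection
  rw [hmass'] at hmain
  have hE : -(∫ x in halfPlane, ∫ y in halfPlane, Gker x y * (x 1 * ω x) * (y 1 * ω y)) =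
      1 / (2 * Real.pi) * ∫ x in halfPlane, ∫ y in halfPlane, K x y * ρ x * ρ y := by
    rw [← integral_const_mul, ← integral_neg]
    congr with x
    rw [← integral_const_mul, ← integral_neg]
    congr with y
    simp only [Gker, hK, hρ]
    ring
  have hL : ∫ x in halfPlane, |Real.log ε| * x 1 * γ * ρ x =
      |Real.log ε| * γ * ∫ x in halfPlane, x 1 ^ 2 * ω x := by
    rw [← integral_const_mul]
    congr with x
    simp only [hρ]
    ring
  rw [hL] at hmain
  have hfin : ∀ I J : ℝ, 1 / (2 * Real.pi) * I -
      γ ^ 2 / (2 * Real.pi) * |Real.log ε| * ((1 / γ) * J) =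
        1 / (2 * Real.pi) * (I - |Real.log ε| * γ * J) := fun I J ↦ by
    field_simp
  rw [hE, hfin, abs_mul, abs_of_pos (by positivity : 0 < 1 / (2 * Real.pi))]
  gcongr
end

section
/- Let N ≥ 2, γ ∈ ℝ, r* > 0 and T > 0. Let q = (q₁, …, q_N) : [0, T] → (ℝ²)^N be C¹ with q_i(t) ≠ q_j(t) for all i ≠ j and t ∈ [0, T], satisfying for each i the ODE dq_i/dt = (γ/(2π))·Σ_{j≠i} (q_i − q_j)^⊥/|q_i − q_j|² − (γ/(4π(r*)²))·q_{i,r}·e_z. Then the Hamiltonian H₀(q(t)) := (1/2)·Σ_{i≠j} ln|q_i(t) − q_j(t)| + (1/(4(r*)²))·Σ_{i=1}^N q_{i,r}(t)² is constant: H₀(q(t)) = H₀(q(0)) for all t ∈ [0, T]. -/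
open Finset

/-- Counterclockwise rotation by `π/2`: for `a = (a_z, a_r)`, `a^⊥ = (−a_r, a_z)`.
Points of `ℝ²` are written with coordinate `0` the `z`-coordinate and
coordinate `1` the `r`-coordinate. -/
noncomputable def perp (a : EuclideanSpace ℝ (Fin 2)) : EuclideanSpace ℝ (Fin 2) :=
  (WithLp.equiv 2 (Fin 2 → ℝ)).symm ![-(a 1), a 0]

/-- The unit vector `e_z = (1, 0)`. -/
noncomputable def ez : EuclideanSpace ℝ (Fin 2) :=
  (WithLp.equiv 2 (Fin 2 → ℝ)).symm ![1, 0]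

/-- The right-hand side of the limiting leapfrogging point system:
`(γ/(2π))·Σ_{j≠i} (q_i − q_j)^⊥/|q_i − q_j|² − (γ/(4π(r*)²))·q_{i,r}·e_z`. -/
noncomputable def lfRHS (N : ℕ) (γ rstar : ℝ)
    (q : Fin N → EuclideanSpace ℝ (Fin 2)) (i : Fin N) : EuclideanSpace ℝ (Fin 2) :=
  (γ/(2*Real.pi)) • (∑ j ∈ univ.erase i, (‖q i - q j‖^2)⁻¹ • perp (q i - q j))
    - (γ/(4*Real.pi*rstar^2) * q i 1) • ez

/-- The Hamiltonian
`H₀(q) = (1/2)·Σ_{i≠j} ln|q_i − q_j| + (1/(4(r*)²))·Σ_i q_{i,r}²`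
(the sum `Σ_{i≠j}` is over ordered pairs). -/
noncomputable def H0 (N : ℕ) (rstar : ℝ)
    (q : Fin N → EuclideanSpace ℝ (Fin 2)) : ℝ :=
  (1/2) * (∑ i, ∑ j ∈ univ.erase i, Real.log ‖q i - q j‖)
    + (1/(4*rstar^2)) * ∑ i, (q i 1)^2

/-- The planar point-vortex interaction `Σ_{j≠i} (q_i − q_j)/|q_i − q_j|²`, the gradient in `q_i`
of the logarithmic energy. -/
noncomputable def logGrad {N : ℕ} (q : Fin N → EuclideanSpace ℝ (Fin 2)) (i : Fin N) :
    EuclideanSpace ℝ (Fin 2) :=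
  ∑ j ∈ univ.erase i, (‖q i - q j‖^2)⁻¹ • (q i - q j)

theorem hasDerivWithinAt_log_norm {E : Type*} [NormedAddCommGroup E] [InnerProductSpace ℝ E]
    {u : ℝ → E} {u' : E} {s : Set ℝ} {t : ℝ} (hu : HasDerivWithinAt u u' s t) (h0 : u t ≠ 0) :
    HasDerivWithinAt (fun x => Real.log ‖u x‖) (inner ℝ ((‖u t‖^2)⁻¹ • u t) u') s t := by
  have hne : ‖u t‖ ^ 2 ≠ 0 := pow_ne_zero 2 (norm_ne_zero_iff.mpr h0)
  have h := (hu.norm_sq.log hne).const_mul (1/2 : ℝ)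
  refine (h.congr_deriv ?_).congr_of_eventuallyEq ?_ ?_
  · rw [real_inner_smul_left]
    field_simp
  · filter_upwards with x
    rw [Real.log_pow]
    push_cast
    ring
  · rw [Real.log_pow]
    push_cast
    ring

theorem sum_erase_inner_sub {ι E : Type*} [Fintype ι] [DecidableEq ι] [NormedAddCommGroup E]
    [InnerProductSpace ℝ E] (k : ι → ι → E) (v : ι → E) (hk : ∀ i j, k j i = -k i j) :
    ∑ i, ∑ j ∈ univ.erase i, inner ℝ (k i j) (v i - v j)
      = 2 * ∑ i, inner ℝ (∑ j ∈ univ.erase i, k i j) (v i) := by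
  have hswap : ∑ i, ∑ j ∈ univ.erase i, inner ℝ (k i j) (v j)
      = -∑ i, ∑ j ∈ univ.erase i, inner ℝ (k i j) (v i) := by
    rw [Finset.sum_comm' (t' := univ) (s' := fun j => univ.erase j) (by simp [eq_comm])]
    simp only [← Finset.sum_neg_distrib]
    refine Finset.sum_congr rfl fun i _ => Finset.sum_congr rfl fun j _ => ?_
    rw [hk i j, inner_neg_left]
  simp only [inner_sub_right, Finset.sum_sub_distrib, sum_inner]
  rw [hswap]
  ring

theorem lfRHS_apply_zero (N : ℕ) (γ rstar : ℝ) (q : Fin N → EuclideanSpace ℝ (Fin 2)) (i : Fin N) :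
    lfRHS N γ rstar q i 0
      = -(γ/(2*Real.pi)) * logGrad q i 1 - γ/(4*Real.pi*rstar^2) * q i 1 := by
  simp only [lfRHS, logGrad, perp, ez, PiLp.sub_apply, PiLp.smul_apply, WithLp.ofLp_sum,
    Finset.sum_apply, smul_eq_mul, WithLp.equiv_symm_apply, Matrix.cons_val_zero, mul_neg,
    Finset.sum_neg_distrib, WithLp.ofLp_smul, Pi.smul_apply]
  ring

theorem lfRHS_apply_one (N : ℕ) (γ rstar : ℝ) (q : Fin N → EuclideanSpace ℝ (Fin 2)) (i : Fin N) :
    lfRHS N γ rstar q i 1 = γ/(2*Real.pi) * logGrad q i 0 := by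
  simp [lfRHS, logGrad, perp, ez]

/-- The vector field of the leapfrogging system is orthogonal, vortex by vortex, to the gradient
of the Hamiltonian. -/
theorem inner_logGrad_lfRHS (N : ℕ) (γ rstar : ℝ) (q : Fin N → EuclideanSpace ℝ (Fin 2))
    (i : Fin N) :
    inner ℝ (logGrad q i) (lfRHS N γ rstar q i)
      + 1/(2*rstar^2) * (q i 1 * lfRHS N γ rstar q i 1) = 0 := by
  rw [PiLp.inner_apply, Fin.sum_univ_two, lfRHS_apply_zero, lfRHS_apply_one]
  simp only [RCLike.inner_apply, conj_trivial]
  rw [show γ/(4*Real.pi*rstar^2) = γ/(2*Real.pi) * (1/(2*rstar^2)) by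
    rw [div_mul_div_comm]; ring]
  ring

theorem hasDerivWithinAt_H0 {N : ℕ} (rstar : ℝ) {q : ℝ → Fin N → EuclideanSpace ℝ (Fin 2)}
    {v : Fin N → EuclideanSpace ℝ (Fin 2)} {s : Set ℝ} {t : ℝ}
    (hsep : ∀ i j, i ≠ j → q t i ≠ q t j)
    (hq : ∀ i, HasDerivWithinAt (fun x => q x i) (v i) s t) :
    HasDerivWithinAt (fun x => H0 N rstar (q x))
      (∑ i, (inner ℝ (logGrad (q t) i) (v i) + 1/(2*rstar^2) * (q t i 1 * v i 1))) s t := by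
  have hlog : HasDerivWithinAt
      (fun x => ∑ i, ∑ j ∈ univ.erase i, Real.log ‖q x i - q x j‖)
      (∑ i, ∑ j ∈ univ.erase i,
        inner ℝ ((‖q t i - q t j‖^2)⁻¹ • (q t i - q t j)) (v i - v j)) s t := by
    refine HasDerivWithinAt.fun_sum fun i _ => HasDerivWithinAt.fun_sum fun j hj => ?_
    exact hasDerivWithinAt_log_norm ((hq i).sub (hq j))
      (sub_ne_zero.mpr (hsep i j (Finset.ne_of_mem_erase hj).symm))
  have hsq : HasDerivWithinAt (fun x => ∑ i, (q x i 1)^2) (∑ i, 2 * (q t i 1 * v i 1)) s t := by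
    refine HasDerivWithinAt.fun_sum fun i _ => ?_
    have h1 : HasDerivWithinAt (fun x => q x i 1) (v i 1) s t :=
      (EuclideanSpace.proj (𝕜 := ℝ) (1 : Fin 2)).hasFDerivAt.comp_hasDerivWithinAt t (hq i)
    refine (h1.pow 2).congr_deriv ?_
    push_cast
    ring
  refine ((hlog.const_mul (1/2)).add (hsq.const_mul (1/(4*rstar^2)))).congr_deriv ?_
  rw [sum_erase_inner_sub (fun i j => (‖q t i - q t j‖^2)⁻¹ • (q t i - q t j)) v
    fun i j => by rw [norm_sub_rev, ← smul_neg, neg_sub]]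
  rw [Finset.sum_add_distrib, ← Finset.mul_sum, ← Finset.mul_sum]
  simp only [logGrad]
  rw [show 1/(4*rstar^2) = 1/2 * (1/(2*rstar^2)) by rw [div_mul_div_comm]; ring]
  ring

/-- Along any `C¹` collisionless solution of the limiting leapfrogging point system on
`[0, T]`, the Hamiltonian `H₀` is conserved. -/
theorem stmt_10 (N : ℕ) (hN : 2 ≤ N) (γ rstar T : ℝ) (hr : 0 < rstar) (hT : 0 < T)
    (q : ℝ → Fin N → EuclideanSpace ℝ (Fin 2))
    (hsep : ∀ t ∈ Set.Icc (0:ℝ) T, ∀ i j, i ≠ j → q t i ≠ q t j)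
    (hode : ∀ i, ∀ t ∈ Set.Icc (0:ℝ) T,
      HasDerivWithinAt (fun s => q s i) (lfRHS N γ rstar (q t) i) (Set.Icc 0 T) t) :
    ∀ t ∈ Set.Icc (0:ℝ) T, H0 N rstar (q t) = H0 N rstar (q 0) := by
  have hderiv : ∀ t ∈ Set.Icc (0:ℝ) T,
      HasDerivWithinAt (fun x => H0 N rstar (q x)) 0 (Set.Icc 0 T) t := fun t ht =>
    (hasDerivWithinAt_H0 rstar (hsep t ht) fun i => hode i t ht).congr_deriv
      (Finset.sum_eq_zero fun i _ => inner_logGrad_lfRHS N γ rstar (q t) i)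
  intro t ht
  have h := (convex_Icc (0:ℝ) T).norm_image_sub_le_of_norm_hasDerivWithin_le (C := 0)
    hderiv (by simp) (Set.left_mem_Icc.mpr hT.le) ht
  rw [zero_mul] at h
  exact sub_eq_zero.mp (norm_le_zero_iff.mp h)
end

section
/- Let N ≥ 2, γ > 0, r* > 0 and T > 0. Let q = (q₁, …, q_N) : [0, T] → (ℝ²)^N be C¹ with q_i(t) ≠ q_j(t) for all i ≠ j and t ∈ [0, T], satisfying for each i the ODE dq_i/dt = (γ/(2π))·Σ_{j≠i} (q_i − q_j)^⊥/|q_i − q_j|² − (γ/(4π(r*)²))·q_{i,r}·e_z. Then for all t ∈ [0, T] and all i ≠ j, |q_i(t) − q_j(t)| ≥ min(1, exp(2·H₀(q(0)) − 2√2·N^{3/2}·√(I(0))·e^{γT/(16π(r*)²)} − (I(0)/(r*)²)·e^{γT/(8π(r*)²)})), where I(0) = (1/2)·Σ_i |q_i(0)|² and H₀(q) = (1/2)·Σ_{i≠j} ln|q_i − q_j| + (1/(4(r*)²))·Σ_i q_{i,r}². In particular, solutions admit no collision in finite time. -/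
open Finset

/-- The angular momentum `I(q) = (1/2)·Σ_i |q_i|²`. -/
noncomputable def Imom (N : ℕ) (q : Fin N → EuclideanSpace ℝ (Fin 2)) : ℝ :=
  (1/2) * ∑ i, ‖q i‖^2

/-- Squared distance of the planar points `(x i, y i)` and `(x j, y j)`. -/
def sqDist {ι : Type*} (x y : ι → ℝ) (i j : ι) : ℝ := (x i - x j) ^ 2 + (y i - y j) ^ 2

section Algebra

variable {ι : Type*}

lemma sqDist_comm (x y : ι → ℝ) (i j : ι) : sqDist x y i j = sqDist x y j i := by
  unfold sqDist; ring

lemma sqDist_self (x y : ι → ℝ) (i : ι) : sqDist x y i i = 0 := by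
  simp [sqDist]

lemma sqDist_nonneg (x y : ι → ℝ) (i j : ι) : 0 ≤ sqDist x y i j := by
  unfold sqDist; positivity

variable [Fintype ι]

lemma sum_mul_antisymm (a : ι → ℝ) (w : ι → ι → ℝ) (hw : ∀ i j, w i j = -w j i) :
    ∑ i, a i * ∑ j, w i j = 1 / 2 * ∑ i, ∑ j, (a i - a j) * w i j := by
  have h : ∑ i, ∑ j, a j * w i j = -∑ i, ∑ j, a i * w i j := by
    rw [sum_comm, ← sum_neg_distrib]
    refine sum_congr rfl fun i _ => ?_
    rw [← sum_neg_distrib]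
    exact sum_congr rfl fun j _ => by rw [hw j i]; ring
  simp only [sub_mul, sum_sub_distrib, h, mul_sum]
  ring

/-- The gradient of the logarithmic interaction, with kernel `w` in place of `1 / sqDist`. -/
noncomputable def gradSum (w : ι → ι → ℝ) (x : ι → ℝ) (i : ι) : ℝ := ∑ j, w i j * (x i - x j)

lemma sum_mul_gradSum (w : ι → ι → ℝ) (hw : ∀ i j, w i j = w j i) (a x : ι → ℝ) :
    ∑ i, a i * gradSum w x i = 1 / 2 * ∑ i, ∑ j, (a i - a j) * (w i j * (x i - x j)) :=
  sum_mul_antisymm a (fun i j => w i j * (x i - x j)) fun i j => by rw [hw i j]; ring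

/-- First component of the velocity field. -/
noncomputable def velX (c R : ℝ) (x y : ι → ℝ) (i : ι) : ℝ :=
  -(2 * c * R ^ 2) * gradSum (fun i j => (sqDist x y i j)⁻¹) y i - c * y i

/-- Second component of the velocity field. -/
noncomputable def velY (c R : ℝ) (x y : ι → ℝ) (i : ι) : ℝ :=
  2 * c * R ^ 2 * gradSum (fun i j => (sqDist x y i j)⁻¹) x i

lemma sum_mul_gradSum_comm (w : ι → ι → ℝ) (hw : ∀ i j, w i j = w j i) (x y : ι → ℝ) :
    ∑ i, y i * gradSum w x i = ∑ i, x i * gradSum w y i := by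
  rw [sum_mul_gradSum w hw, sum_mul_gradSum w hw]
  congr 1
  exact sum_congr rfl fun i _ => sum_congr rfl fun j _ => by ring

lemma sum_pos_mul_vel (c R : ℝ) (x y : ι → ℝ) :
    ∑ i, (x i * velX c R x y i + y i * velY c R x y i) = -c * ∑ i, x i * y i := by
  have h := sum_mul_gradSum_comm (fun i j => (sqDist x y i j)⁻¹)
    (fun i j => by rw [sqDist_comm]) x y
  have e : ∀ i, x i * velX c R x y i + y i * velY c R x y i =
      2 * c * R ^ 2 * (y i * gradSum (fun i j => (sqDist x y i j)⁻¹) x i)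
      - 2 * c * R ^ 2 * (x i * gradSum (fun i j => (sqDist x y i j)⁻¹) y i)
      + -c * (x i * y i) := fun i => by unfold velX velY; ring
  simp only [e, sum_add_distrib, sum_sub_distrib, ← mul_sum, h]
  ring

/-- Time derivative of a pair interaction with kernel `w` along the velocity field. -/
lemma pair_vel (w : ι → ι → ℝ) (hw : ∀ i j, w i j = w j i) (x y a b : ι → ℝ) :
    1 / 2 * ∑ i, ∑ j, w i j * ((x i - x j) * (a i - a j) + (y i - y j) * (b i - b j)) =
      ∑ i, (a i * gradSum w x i + b i * gradSum w y i) := by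
  rw [sum_add_distrib, sum_mul_gradSum w hw, sum_mul_gradSum w hw, ← mul_add,
    ← sum_add_distrib]
  congr 1
  refine sum_congr rfl fun i _ => ?_
  rw [← sum_add_distrib]
  exact sum_congr rfl fun j _ => by ring

lemma energy_rate_eq_zero {c R : ℝ} (hR : 0 < R) (x y : ι → ℝ) :
    1 / (2 * R ^ 2) * ∑ i, y i * velY c R x y i +
      ∑ i, (velX c R x y i * gradSum (fun i j => (sqDist x y i j)⁻¹) x i +
        velY c R x y i * gradSum (fun i j => (sqDist x y i j)⁻¹) y i) = 0 := by
  rw [mul_sum, ← sum_add_distrib]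
  refine sum_eq_zero fun i _ => ?_
  unfold velX velY
  field_simp
  ring

/-- The softened interaction of a triple, seen along one of its sides. -/
lemma triple_bound {s : ℝ} (hs : 0 < s) (a₁ a₂ b₁ b₂ : ℝ) :
    ((a₁ - b₁) ^ 2 + (a₂ - b₂) ^ 2)⁻¹ *
      (((s ^ 2 + (a₁ ^ 2 + a₂ ^ 2))⁻¹ * a₂ - (s ^ 2 + (b₁ ^ 2 + b₂ ^ 2))⁻¹ * b₂) * (a₁ - b₁)
      - ((s ^ 2 + (a₁ ^ 2 + a₂ ^ 2))⁻¹ * a₁ - (s ^ 2 + (b₁ ^ 2 + b₂ ^ 2))⁻¹ * b₁) * (a₂ - b₂))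
    ≤ (s ^ 2)⁻¹ * ((a₁ ^ 2 + a₂ ^ 2) / (s ^ 2 + (a₁ ^ 2 + a₂ ^ 2))
      + (b₁ ^ 2 + b₂ ^ 2) / (s ^ 2 + (b₁ ^ 2 + b₂ ^ 2))) := by
  have hA : 0 < s ^ 2 + (a₁ ^ 2 + a₂ ^ 2) := by positivity
  have hB : 0 < s ^ 2 + (b₁ ^ 2 + b₂ ^ 2) := by positivity
  rcases (add_nonneg (sq_nonneg (a₁ - b₁)) (sq_nonneg (a₂ - b₂))).eq_or_lt with h | hd
  · rw [← h, inv_zero, zero_mul]; positivity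
  have key : (a₁ * b₂ - a₂ * b₁) * ((b₁ ^ 2 + b₂ ^ 2) - (a₁ ^ 2 + a₂ ^ 2)) ≤
      ((a₁ - b₁) ^ 2 + (a₂ - b₂) ^ 2) * ((a₁ ^ 2 + a₂ ^ 2) + (b₁ ^ 2 + b₂ ^ 2)) := by
    nlinarith [sq_nonneg ((a₁ - b₁) * (a₂ + b₂) - (a₂ - b₂) * (a₁ + b₁)
        + ((a₁ - b₁) * (a₁ + b₁) + (a₂ - b₂) * (a₂ + b₂))),
      mul_nonneg hd.le (add_nonneg (sq_nonneg (a₁ - b₁)) (sq_nonneg (a₂ - b₂)))]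
  have e : ((s ^ 2 + (a₁ ^ 2 + a₂ ^ 2))⁻¹ * a₂ - (s ^ 2 + (b₁ ^ 2 + b₂ ^ 2))⁻¹ * b₂) * (a₁ - b₁)
      - ((s ^ 2 + (a₁ ^ 2 + a₂ ^ 2))⁻¹ * a₁ - (s ^ 2 + (b₁ ^ 2 + b₂ ^ 2))⁻¹ * b₁) * (a₂ - b₂)
      = (a₁ * b₂ - a₂ * b₁) * ((b₁ ^ 2 + b₂ ^ 2) - (a₁ ^ 2 + a₂ ^ 2)) /
        ((s ^ 2 + (a₁ ^ 2 + a₂ ^ 2)) * (s ^ 2 + (b₁ ^ 2 + b₂ ^ 2))) := by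
    field_simp
    ring
  rw [e]
  calc _ ≤ ((a₁ - b₁) ^ 2 + (a₂ - b₂) ^ 2)⁻¹ *
        (((a₁ - b₁) ^ 2 + (a₂ - b₂) ^ 2) * ((a₁ ^ 2 + a₂ ^ 2) + (b₁ ^ 2 + b₂ ^ 2)) /
        ((s ^ 2 + (a₁ ^ 2 + a₂ ^ 2)) * (s ^ 2 + (b₁ ^ 2 + b₂ ^ 2)))) := by gcongr
    _ = ((a₁ ^ 2 + a₂ ^ 2) + (b₁ ^ 2 + b₂ ^ 2)) /
        ((s ^ 2 + (a₁ ^ 2 + a₂ ^ 2)) * (s ^ 2 + (b₁ ^ 2 + b₂ ^ 2))) := by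
      field_simp
    _ ≤ _ := by
      have h : (s ^ 2)⁻¹ * ((a₁ ^ 2 + a₂ ^ 2) / (s ^ 2 + (a₁ ^ 2 + a₂ ^ 2))
          + (b₁ ^ 2 + b₂ ^ 2) / (s ^ 2 + (b₁ ^ 2 + b₂ ^ 2))) -
          ((a₁ ^ 2 + a₂ ^ 2) + (b₁ ^ 2 + b₂ ^ 2)) /
          ((s ^ 2 + (a₁ ^ 2 + a₂ ^ 2)) * (s ^ 2 + (b₁ ^ 2 + b₂ ^ 2))) =
          2 * (a₁ ^ 2 + a₂ ^ 2) * (b₁ ^ 2 + b₂ ^ 2) / (s ^ 2 *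
          ((s ^ 2 + (a₁ ^ 2 + a₂ ^ 2)) * (s ^ 2 + (b₁ ^ 2 + b₂ ^ 2)))) := by
        field_simp
        ring
      have : 0 ≤ 2 * (a₁ ^ 2 + a₂ ^ 2) * (b₁ ^ 2 + b₂ ^ 2) / (s ^ 2 *
          ((s ^ 2 + (a₁ ^ 2 + a₂ ^ 2)) * (s ^ 2 + (b₁ ^ 2 + b₂ ^ 2)))) := by positivity
      linarith

lemma softened_interaction_le {s : ℝ} (hs : 0 < s) (x y : ι → ℝ) :
    ∑ i, (gradSum (fun i j => (s ^ 2 + sqDist x y i j)⁻¹) y i *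
          gradSum (fun i j => (sqDist x y i j)⁻¹) x i
        - gradSum (fun i j => (s ^ 2 + sqDist x y i j)⁻¹) x i *
          gradSum (fun i j => (sqDist x y i j)⁻¹) y i) ≤
      Fintype.card ι * (s ^ 2)⁻¹ *
        ∑ i, ∑ j, sqDist x y i j / (s ^ 2 + sqDist x y i j) := by
  have hD : ∀ i j, (sqDist x y i j)⁻¹ = (sqDist x y j i)⁻¹ := fun i j => by rw [sqDist_comm]
  rw [sum_sub_distrib, sum_mul_gradSum _ hD, sum_mul_gradSum _ hD, ← mul_sub,
    ← sum_sub_distrib]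
  simp only [← sum_sub_distrib]
  set u : ι → ι → ℝ := fun i j => sqDist x y i j / (s ^ 2 + sqDist x y i j) with hu
  have hterm : ∀ i k,
      (gradSum (fun i j => (s ^ 2 + sqDist x y i j)⁻¹) y i -
        gradSum (fun i j => (s ^ 2 + sqDist x y i j)⁻¹) y k) *
        ((sqDist x y i k)⁻¹ * (x i - x k)) -
      (gradSum (fun i j => (s ^ 2 + sqDist x y i j)⁻¹) x i -
        gradSum (fun i j => (s ^ 2 + sqDist x y i j)⁻¹) x k) *
        ((sqDist x y i k)⁻¹ * (y i - y k)) ≤ ∑ j, (s ^ 2)⁻¹ * (u i j + u k j) := by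
    intro i k
    unfold gradSum
    rw [← sum_sub_distrib, ← sum_sub_distrib, sum_mul, sum_mul, ← sum_sub_distrib]
    refine sum_le_sum fun j _ => ?_
    have := triple_bound hs (x i - x j) (y i - y j) (x k - x j) (y k - y j)
    simp only [sub_sub_sub_cancel_right] at this
    simp only [hu, sqDist]
    refine le_trans (le_of_eq ?_) this
    ring
  calc _ ≤ 1 / 2 * ∑ i, ∑ k, ∑ j, (s ^ 2)⁻¹ * (u i j + u k j) := by
        gcongr with i _ k _
        exact hterm i k
    _ = _ := by
      simp only [mul_add, sum_add_distrib, sum_const, card_univ, nsmul_eq_mul, ← mul_sum]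
      ring

lemma sum_sum_ne_one [DecidableEq ι] :
    ∑ i : ι, ∑ j : ι, (if i = j then (0 : ℝ) else 1) =
      Fintype.card ι * (Fintype.card ι - 1) := by
  have : ∀ i j : ι, (if i = j then (0 : ℝ) else 1) = 1 - if i = j then 1 else 0 := by
    intro i j; split_ifs <;> simp
  simp only [this, sum_sub_distrib, sum_ite_eq, mem_univ, if_true, sum_const, card_univ,
    nsmul_eq_mul]
  ring

lemma softened_rate_le {c R s : ℝ} (hc : 0 < c) (hR : 0 < R) (hs : 0 < s)
    (hsR : 8 * Fintype.card ι * R ^ 2 ≤ s ^ 2) (x y : ι → ℝ) :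
    1 / (2 * R ^ 2) * ∑ i, y i * velY c R x y i +
      ∑ i, (velX c R x y i * gradSum (fun i j => (s ^ 2 + sqDist x y i j)⁻¹) x i +
        velY c R x y i * gradSum (fun i j => (s ^ 2 + sqDist x y i j)⁻¹) y i) ≤
      c / 4 * (Fintype.card ι * (Fintype.card ι - 1)) := by
  classical
  have hI := softened_interaction_le hs x y
  have hD : ∀ i j, (sqDist x y i j)⁻¹ = (sqDist x y j i)⁻¹ := fun i j => by rw [sqDist_comm]
  have hDs : ∀ i j, (s ^ 2 + sqDist x y i j)⁻¹ = (s ^ 2 + sqDist x y j i)⁻¹ :=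
    fun i j => by rw [sqDist_comm]
  set U := ∑ i, ∑ j, sqDist x y i j / (s ^ 2 + sqDist x y i j) with hU
  have hU0 : 0 ≤ U := sum_nonneg fun i _ => sum_nonneg fun j _ => by
    have := sqDist_nonneg x y i j
    positivity
  have hshear : ∑ i, y i * gradSum (fun i j => (sqDist x y i j)⁻¹) x i -
      ∑ i, y i * gradSum (fun i j => (s ^ 2 + sqDist x y i j)⁻¹) x i ≤
      1 / 4 * (Fintype.card ι * (Fintype.card ι - 1) - U) := by
    rw [sum_mul_gradSum _ hD, sum_mul_gradSum _ hDs, ← sum_sum_ne_one, hU, ← mul_sub]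
    simp only [← sum_sub_distrib]
    rw [mul_sum, mul_sum]
    refine sum_le_sum fun i _ => ?_
    rw [mul_sum, mul_sum]
    refine sum_le_sum fun j _ => ?_
    split_ifs with h
    · subst h; simp [sqDist_self]
    rcases (sqDist_nonneg x y i j).eq_or_lt with h0 | h0
    · have hxy : x i - x j = 0 := by unfold sqDist at h0; nlinarith [sq_nonneg (x i - x j), sq_nonneg (y i - y j)]
      rw [← h0, hxy]; norm_num
    have hp : 2 * ((y i - y j) * (x i - x j)) ≤ sqDist x y i j := by
      unfold sqDist; nlinarith [sq_nonneg ((x i - x j) - (y i - y j))]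
    generalize sqDist x y i j = D at *
    have h1 : 1 - D / (s ^ 2 + D) = D * (s ^ 2 / (D * (s ^ 2 + D))) := by field_simp; ring
    have h2 : (y i - y j) * (D⁻¹ * (x i - x j)) - (y i - y j) * ((s ^ 2 + D)⁻¹ * (x i - x j))
        = (y i - y j) * (x i - x j) * (s ^ 2 / (D * (s ^ 2 + D))) := by field_simp; ring
    rw [h1, h2]
    have : 0 ≤ s ^ 2 / (D * (s ^ 2 + D)) := by positivity
    nlinarith [mul_le_mul_of_nonneg_right hp this]
  have e : 1 / (2 * R ^ 2) * ∑ i, y i * velY c R x y i +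
      ∑ i, (velX c R x y i * gradSum (fun i j => (s ^ 2 + sqDist x y i j)⁻¹) x i +
        velY c R x y i * gradSum (fun i j => (s ^ 2 + sqDist x y i j)⁻¹) y i) =
      2 * c * R ^ 2 * ∑ i, (gradSum (fun i j => (s ^ 2 + sqDist x y i j)⁻¹) y i *
          gradSum (fun i j => (sqDist x y i j)⁻¹) x i
        - gradSum (fun i j => (s ^ 2 + sqDist x y i j)⁻¹) x i *
          gradSum (fun i j => (sqDist x y i j)⁻¹) y i) +
      c * (∑ i, y i * gradSum (fun i j => (sqDist x y i j)⁻¹) x i -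
      ∑ i, y i * gradSum (fun i j => (s ^ 2 + sqDist x y i j)⁻¹) x i) := by
    rw [← sum_sub_distrib, mul_sum, mul_sum, mul_sum, ← sum_add_distrib, ← sum_add_distrib]
    refine sum_congr rfl fun i _ => ?_
    unfold velX velY
    field_simp
    ring
  rw [e]
  have h1 : 2 * c * R ^ 2 * (Fintype.card ι * (s ^ 2)⁻¹ * U) ≤ c / 4 * U := by
    have : 8 * Fintype.card ι * R ^ 2 * (s ^ 2)⁻¹ ≤ 1 := by
      rw [← div_eq_mul_inv]; exact div_le_one_of_le₀ hsR (by positivity)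
    nlinarith [mul_le_mul_of_nonneg_left this (mul_nonneg hc.le hU0)]
  have h2 := mul_le_mul_of_nonneg_left hI (show 0 ≤ 2 * c * R ^ 2 by positivity)
  have h3 := mul_le_mul_of_nonneg_left hshear hc.le
  linarith

end Algebra

section Dynamics

variable {ι : Type*} [Fintype ι]

/-- The leapfrogging system on `[0, T]` in real coordinates, without collisions. -/
structure IsLeapfrogSolution (c R T : ℝ) (x y : ℝ → ι → ℝ) : Prop where
  sqDist_pos : ∀ t ∈ Set.Icc 0 T, ∀ i j, i ≠ j → 0 < sqDist (x t) (y t) i j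
  deriv_x : ∀ t ∈ Set.Icc 0 T, ∀ i,
    HasDerivWithinAt (fun s => x s i) (velX c R (x t) (y t) i) (Set.Icc 0 T) t
  deriv_y : ∀ t ∈ Set.Icc 0 T, ∀ i,
    HasDerivWithinAt (fun s => y s i) (velY c R (x t) (y t) i) (Set.Icc 0 T) t

lemma antitoneOn_Icc_of_hasDerivWithinAt {T : ℝ} {f f' : ℝ → ℝ}
    (hf : ∀ t ∈ Set.Icc 0 T, HasDerivWithinAt f (f' t) (Set.Icc 0 T) t)
    (hf' : ∀ t ∈ Set.Icc 0 T, f' t ≤ 0) : AntitoneOn f (Set.Icc 0 T) :=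
  antitoneOn_of_hasDerivWithinAt_nonpos (convex_Icc 0 T)
    (fun t ht => (hf t ht).continuousWithinAt)
    (fun t ht => (hf t (interior_subset ht)).mono interior_subset)
    (fun t ht => hf' t (interior_subset ht))

lemma monotoneOn_Icc_of_hasDerivWithinAt {T : ℝ} {f f' : ℝ → ℝ}
    (hf : ∀ t ∈ Set.Icc 0 T, HasDerivWithinAt f (f' t) (Set.Icc 0 T) t)
    (hf' : ∀ t ∈ Set.Icc 0 T, 0 ≤ f' t) : MonotoneOn f (Set.Icc 0 T) :=
  monotoneOn_of_hasDerivWithinAt_nonneg (convex_Icc 0 T)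
    (fun t ht => (hf t ht).continuousWithinAt)
    (fun t ht => (hf t (interior_subset ht)).mono interior_subset)
    (fun t ht => hf' t (interior_subset ht))

namespace IsLeapfrogSolution

variable {c R T : ℝ} {x y : ℝ → ι → ℝ}

lemma mono (h : IsLeapfrogSolution c R T x y) {S : ℝ} (hS : S ≤ T) :
    IsLeapfrogSolution c R S x y where
  sqDist_pos t ht := h.sqDist_pos t (Set.Icc_subset_Icc_right hS ht)
  deriv_x t ht i := (h.deriv_x t (Set.Icc_subset_Icc_right hS ht) i).mono
    (Set.Icc_subset_Icc_right hS)
  deriv_y t ht i := (h.deriv_y t (Set.Icc_subset_Icc_right hS ht) i).mono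
    (Set.Icc_subset_Icc_right hS)

lemma hasDerivWithinAt_pair (h : IsLeapfrogSolution c R T x y) {t : ℝ} (ht : t ∈ Set.Icc 0 T)
    (f w : ℝ → ℝ) (hf : ∀ d, 0 < d → HasDerivAt f (w d) d) :
    HasDerivWithinAt (fun s => 1 / 4 * ∑ i, ∑ j, f (sqDist (x s) (y s) i j))
      (∑ i, (velX c R (x t) (y t) i * gradSum (fun i j => w (sqDist (x t) (y t) i j)) (x t) i +
        velY c R (x t) (y t) i * gradSum (fun i j => w (sqDist (x t) (y t) i j)) (y t) i))
      (Set.Icc 0 T) t := by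
  have hterm : ∀ i j, HasDerivWithinAt (fun s => f (sqDist (x s) (y s) i j))
      (w (sqDist (x t) (y t) i j) *
        (2 * ((x t i - x t j) * (velX c R (x t) (y t) i - velX c R (x t) (y t) j) +
        (y t i - y t j) * (velY c R (x t) (y t) i - velY c R (x t) (y t) j)))) (Set.Icc 0 T) t := by
    intro i j
    by_cases hij : i = j
    · subst hij
      simp only [sqDist_self, sub_self, mul_zero, add_zero]
      exact hasDerivWithinAt_const _ _ _
    · have hd : HasDerivWithinAt (fun s => sqDist (x s) (y s) i j)
          (2 * ((x t i - x t j) * (velX c R (x t) (y t) i - velX c R (x t) (y t) j) +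
        (y t i - y t j) * (velY c R (x t) (y t) i - velY c R (x t) (y t) j)))
          (Set.Icc 0 T) t := by
        have h1 := ((h.deriv_x t ht i).fun_sub (h.deriv_x t ht j)).fun_pow 2
        have h2 := ((h.deriv_y t ht i).fun_sub (h.deriv_y t ht j)).fun_pow 2
        refine (h1.fun_add h2).congr_deriv ?_
        simp only [Nat.cast_ofNat, Nat.add_one_sub_one, pow_one]
        ring
      exact (hf _ (h.sqDist_pos t ht i j hij)).comp_hasDerivWithinAt t hd
  have hsum := (HasDerivWithinAt.fun_sum (u := univ) fun i _ =>
    HasDerivWithinAt.fun_sum (u := univ) fun j _ => hterm i j).const_mul (1 / 4 : ℝ)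
  refine hsum.congr_deriv ?_
  rw [← pair_vel _ (fun i j => by rw [sqDist_comm]), mul_sum, mul_sum]
  refine sum_congr rfl fun i _ => ?_
  rw [mul_sum, mul_sum]
  exact sum_congr rfl fun j _ => by ring

lemma hasDerivWithinAt_sum_sq (h : IsLeapfrogSolution c R T x y) {t : ℝ}
    (ht : t ∈ Set.Icc 0 T) :
    HasDerivWithinAt (fun s => 1 / (4 * R ^ 2) * ∑ i, y s i ^ 2)
      (1 / (2 * R ^ 2) * ∑ i, y t i * velY c R (x t) (y t) i) (Set.Icc 0 T) t := by
  have := (HasDerivWithinAt.fun_sum (u := univ) fun i _ =>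
    (h.deriv_y t ht i).fun_pow 2).const_mul (1 / (4 * R ^ 2))
  refine this.congr_deriv ?_
  rw [mul_sum, mul_sum]
  refine sum_congr rfl fun i _ => ?_
  simp only [Nat.cast_ofNat, Nat.add_one_sub_one, pow_one]
  ring

lemma energy_eq (h : IsLeapfrogSolution c R T x y) (hR : 0 < R) (hT : 0 ≤ T) :
    1 / (4 * R ^ 2) * ∑ i, y T i ^ 2 +
        1 / 4 * ∑ i, ∑ j, Real.log (sqDist (x T) (y T) i j) =
      1 / (4 * R ^ 2) * ∑ i, y 0 i ^ 2 +
        1 / 4 * ∑ i, ∑ j, Real.log (sqDist (x 0) (y 0) i j) := by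
  have hd := fun t ht => (h.hasDerivWithinAt_sum_sq (t := t) ht).fun_add
    (h.hasDerivWithinAt_pair ht Real.log (fun d => d⁻¹) fun d hd => Real.hasDerivAt_log hd.ne')
  have h0 := fun t (_ : t ∈ Set.Icc 0 T) => energy_rate_eq_zero (c := c) hR (x t) (y t)
  exact le_antisymm
    (antitoneOn_Icc_of_hasDerivWithinAt hd (fun t ht => (h0 t ht).le)
      (Set.left_mem_Icc.2 hT) (Set.right_mem_Icc.2 hT) hT)
    (monotoneOn_Icc_of_hasDerivWithinAt hd (fun t ht => (h0 t ht).ge)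
      (Set.left_mem_Icc.2 hT) (Set.right_mem_Icc.2 hT) hT)

lemma softened_energy_le (h : IsLeapfrogSolution c R T x y) (hc : 0 < c) (hR : 0 < R)
    {s : ℝ} (hs : 0 < s) (hsR : 8 * Fintype.card ι * R ^ 2 ≤ s ^ 2)
    {t : ℝ} (ht : t ∈ Set.Icc 0 T) :
    1 / (4 * R ^ 2) * ∑ i, y T i ^ 2 +
        1 / 4 * ∑ i, ∑ j, Real.log (1 + sqDist (x T) (y T) i j / s ^ 2) ≤
      1 / (4 * R ^ 2) * ∑ i, y t i ^ 2 +
        1 / 4 * ∑ i, ∑ j, Real.log (1 + sqDist (x t) (y t) i j / s ^ 2) +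
      c / 4 * (Fintype.card ι * (Fintype.card ι - 1)) * (T - t) := by
  have hlog : ∀ d, 0 < d →
      HasDerivAt (fun d => Real.log (1 + d / s ^ 2)) ((s ^ 2 + d)⁻¹) d := by
    intro d hd
    have h1 : HasDerivAt (fun d : ℝ => 1 + d / s ^ 2) (1 / s ^ 2) d :=
      ((hasDerivAt_id d).div_const _).const_add 1
    refine (h1.log (by positivity)).congr_deriv ?_
    field_simp
  have hd := fun t ht => ((h.hasDerivWithinAt_sum_sq (t := t) ht).fun_add
    (h.hasDerivWithinAt_pair ht _ _ hlog)).fun_sub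
    ((hasDerivWithinAt_id t (Set.Icc 0 T)).const_mul
      (c / 4 * (Fintype.card ι * (Fintype.card ι - 1))))
  have := antitoneOn_Icc_of_hasDerivWithinAt hd (fun t _ => by
    have := softened_rate_le hc hR hs hsR (x t) (y t)
    linarith) ht (Set.right_mem_Icc.2 (ht.1.trans ht.2)) ht.2
  simp only [id] at this
  linarith

lemma moment_le (h : IsLeapfrogSolution c R T x y) (hc : 0 < c) {t : ℝ}
    (ht : t ∈ Set.Icc 0 T) :
    ∑ i, (x t i ^ 2 + y t i ^ 2) ≤ (∑ i, (x 0 i ^ 2 + y 0 i ^ 2)) * Real.exp (c * t) := by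
  have hd : ∀ t ∈ Set.Icc 0 T, HasDerivWithinAt
      (fun s => Real.exp (-c * s) * ∑ i, (x s i ^ 2 + y s i ^ 2))
      (Real.exp (-c * t) * (-c * 1) * ∑ i, (x t i ^ 2 + y t i ^ 2) +
        Real.exp (-c * t) * ∑ i, (2 * x t i * velX c R (x t) (y t) i +
          2 * y t i * velY c R (x t) (y t) i)) (Set.Icc 0 T) t := by
    intro t ht
    refine (((hasDerivWithinAt_id t _).const_mul (-c)).exp).fun_mul
      (HasDerivWithinAt.fun_sum fun i _ => ?_)
    simpa using ((h.deriv_x t ht i).fun_pow 2).fun_add ((h.deriv_y t ht i).fun_pow 2)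
  have hanti := antitoneOn_Icc_of_hasDerivWithinAt hd (fun t _ => by
    have e : ∑ i, (2 * x t i * velX c R (x t) (y t) i + 2 * y t i * velY c R (x t) (y t) i)
        = 2 * (-c * ∑ i, x t i * y t i) := by
      rw [← sum_pos_mul_vel c R, mul_sum]
      exact sum_congr rfl fun i _ => by ring
    have h2 : 0 ≤ ∑ i, (x t i ^ 2 + y t i ^ 2) + 2 * ∑ i, x t i * y t i := by
      rw [mul_sum, ← sum_add_distrib]
      exact sum_nonneg fun i _ => by nlinarith [sq_nonneg (x t i + y t i)]
    rw [e]
    have := mul_nonneg (mul_nonneg hc.le (Real.exp_pos (-c * t)).le) h2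
    linarith) (Set.left_mem_Icc.2 (ht.1.trans ht.2)) ht ht.1
  simp only [mul_zero, Real.exp_zero, one_mul] at hanti
  have := mul_le_mul_of_nonneg_right hanti (Real.exp_pos (c * t)).le
  rw [mul_right_comm, ← Real.exp_add] at this
  simpa using this

end IsLeapfrogSolution

end Dynamics

section Bounds

variable {ι : Type*} [Fintype ι]

lemma sum_sqDist_le (x y : ι → ℝ) :
    ∑ i, ∑ j, sqDist x y i j ≤ 2 * Fintype.card ι * ∑ i, (x i ^ 2 + y i ^ 2) := by
  have key : ∀ a : ι → ℝ, ∑ i, ∑ j, (a i - a j) ^ 2 =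
      2 * Fintype.card ι * ∑ i, a i ^ 2 - 2 * (∑ i, a i) ^ 2 := by
    intro a
    simp only [sub_sq, sum_add_distrib, sum_sub_distrib, sum_const, card_univ, nsmul_eq_mul,
      ← mul_sum, ← sum_mul]
    ring
  simp only [sqDist, sum_add_distrib, key]
  nlinarith [sq_nonneg (∑ i, x i), sq_nonneg (∑ i, y i)]

lemma sum_log_sqDist_le {x y : ι → ℝ} (h : ∀ i j, i ≠ j → 0 < sqDist x y i j) {A : ℝ}
    (hA : 0 < A)
    (hD : ∑ i, ∑ j, sqDist x y i j ≤ Fintype.card ι * (Fintype.card ι - 1) * A) :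
    ∑ i, ∑ j, Real.log (sqDist x y i j) ≤
      Fintype.card ι * (Fintype.card ι - 1) * Real.log A := by
  classical
  have hterm : ∀ i j, Real.log (sqDist x y i j) ≤
      A⁻¹ * sqDist x y i j + (Real.log A - 1) * (if i = j then 0 else 1) := by
    intro i j
    split_ifs with hij
    · subst hij; simp [sqDist_self]
    · have := Real.log_le_sub_one_of_pos (div_pos (h i j hij) hA)
      rw [Real.log_div (h i j hij).ne' hA.ne', div_eq_inv_mul] at this
      linarith
  have := sum_le_sum fun i (_ : i ∈ univ) => sum_le_sum fun j (_ : j ∈ univ) => hterm i j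
  simp only [sum_add_distrib, ← mul_sum, sum_sum_ne_one] at this
  have h2 : A⁻¹ * ∑ i, ∑ j, sqDist x y i j ≤ Fintype.card ι * (Fintype.card ι - 1) := by
    rw [← div_eq_inv_mul, div_le_iff₀ hA]; exact hD
  linarith

lemma sum_log_one_add_sqDist_le {x y : ι → ℝ} {s : ℝ} (hs : 0 < s)
    (hD : ∑ i, ∑ j, sqDist x y i j ≤ Fintype.card ι * (Fintype.card ι - 1) * (s ^ 2 / 3)) :
    ∑ i, ∑ j, Real.log (1 + sqDist x y i j / s ^ 2) ≤
      Fintype.card ι * (Fintype.card ι - 1) * Real.log (4 / 3) := by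
  classical
  have hterm : ∀ i j, Real.log (1 + sqDist x y i j / s ^ 2) ≤
      3 / 4 * (s ^ 2)⁻¹ * sqDist x y i j +
        (Real.log (4 / 3) - 1 / 4) * (if i = j then 0 else 1) := by
    intro i j
    split_ifs with hij
    · subst hij; simp [sqDist_self]
    · have h0 := sqDist_nonneg x y i j
      have h1 : 0 < 1 + sqDist x y i j / s ^ 2 := by positivity
      have := Real.log_le_sub_one_of_pos (div_pos h1 (show (0 : ℝ) < 4 / 3 by norm_num))
      rw [Real.log_div h1.ne' (by norm_num), div_eq_inv_mul (sqDist x y i j)] at this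
      rw [div_eq_inv_mul (sqDist x y i j)]
      linarith
  have := sum_le_sum fun i (_ : i ∈ univ) => sum_le_sum fun j (_ : j ∈ univ) => hterm i j
  simp only [sum_add_distrib, ← mul_sum, sum_sum_ne_one] at this
  have h2 : (s ^ 2)⁻¹ * ∑ i, ∑ j, sqDist x y i j ≤
      Fintype.card ι * (Fintype.card ι - 1) / 3 := by
    rw [← div_eq_inv_mul, div_le_iff₀ (by positivity)]; linarith
  linarith

lemma sum_log_sqDist_le_softened {x y : ι → ℝ} (h : ∀ i j, i ≠ j → 0 < sqDist x y i j) {s : ℝ}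
    (hs : 0 < s) {a b : ι} (hab : a ≠ b) :
    ∑ i, ∑ j, Real.log (sqDist x y i j) ≤
      ∑ i, ∑ j, Real.log (1 + sqDist x y i j / s ^ 2) +
      (Fintype.card ι * (Fintype.card ι - 1) - 2) * Real.log (s ^ 2) +
      2 * Real.log (sqDist x y a b) := by
  classical
  have hterm : ∀ i j, Real.log (sqDist x y i j) ≤ Real.log (1 + sqDist x y i j / s ^ 2) +
      Real.log (s ^ 2) * (if i = j then 0 else 1) +
      (Real.log (sqDist x y a b) - Real.log (s ^ 2)) *
        ((if i = a then if j = b then 1 else 0 else 0) +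
          (if i = b then if j = a then 1 else 0 else 0)) := by
    intro i j
    have h0 := sqDist_nonneg x y i j
    have hpos : 0 ≤ Real.log (1 + sqDist x y i j / s ^ 2) :=
      Real.log_nonneg (by have : 0 ≤ sqDist x y i j / s ^ 2 := by positivity
                          linarith)
    by_cases h1 : i = a ∧ j = b
    · obtain ⟨rfl, rfl⟩ := h1
      simp [hab]; linarith
    by_cases h2 : i = b ∧ j = a
    · obtain ⟨rfl, rfl⟩ := h2
      simp [hab.symm, sqDist_comm x y i j]
      rw [sqDist_comm] at hpos
      linarith
    have e1 : (if i = a then if j = b then (1 : ℝ) else 0 else 0) = 0 := by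
      split_ifs <;> tauto
    have e2 : (if i = b then if j = a then (1 : ℝ) else 0 else 0) = 0 := by
      split_ifs <;> tauto
    rw [e1, e2]
    split_ifs with hij
    · subst hij; simp [sqDist_self]
    · have hp := h i j hij
      have : Real.log (sqDist x y i j) ≤ Real.log ((1 + sqDist x y i j / s ^ 2) * s ^ 2) := by
        refine Real.log_le_log hp ?_
        have : (1 + sqDist x y i j / s ^ 2) * s ^ 2 = s ^ 2 + sqDist x y i j := by field_simp
        rw [this]; nlinarith
      rw [Real.log_mul (by positivity) (by positivity)] at this
      linarith
  have := sum_le_sum fun i (_ : i ∈ univ) => sum_le_sum fun j (_ : j ∈ univ) => hterm i j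
  have e : ∀ a b : ι, ∑ i, ∑ j, (if i = a then if j = b then (1 : ℝ) else 0 else 0) = 1 := by
    intro a b
    rw [sum_eq_single a (by intro i _ hi; simp [hi]) (by simp)]
    simp
  simp only [sum_add_distrib, ← mul_sum, sum_sum_ne_one, e] at this
  linarith

/-- The scalar inequality behind the collision bound: `M` is the number of pairs, `l` the
logarithm of the initial mean distance, `a` the elapsed time and `τ` the switching time. -/
lemma exponent_ineq {M σ a τ l : ℝ} (hM : 1 ≤ M) (hσ : 0 < σ) (hτ : τ ≤ a) (hτ0 : 0 ≤ τ)
    (h : σ * Real.exp (2 * τ) ≤ 2 ∧ (τ = a ∨ σ * Real.exp (2 * τ) = 2) ∨ τ = 0 ∧ 2 ≤ σ) :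
    M * σ * Real.exp (2 * τ) / 2 + M * (a - τ) + M / 2 * Real.log (4 / 3) +
        (M - 1) * (Real.log 3 / 2 + l + τ) + M * l + M * σ / 2 ≤
      2 * √2 * M * Real.exp (l + a / 2) + M * σ * Real.exp a := by
  have ha0 : 0 ≤ a := hτ0.trans hτ
  have hlog4 : Real.log (4 / 3) = 2 * Real.log 2 - Real.log 3 := by
    rw [Real.log_div (by norm_num) (by norm_num), show (4 : ℝ) = 2 ^ 2 by norm_num, Real.log_pow]
    norm_num
  have hlog23 : Real.log 2 ≤ Real.log 3 := Real.log_le_log (by norm_num) (by norm_num)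
  have hy : l + a / 2 + Real.log 2 / 2 ≤ √2 * Real.exp (l + a / 2) - 1 := by
    have := Real.log_le_sub_one_of_pos
      (show 0 < √2 * Real.exp (l + a / 2) by positivity)
    rw [Real.log_mul (by positivity) (by positivity), Real.log_exp,
      Real.log_sqrt (by norm_num)] at this
    linarith
  have hy' := mul_le_mul_of_nonneg_left hy (show 0 ≤ 2 * M - 1 by linarith)
  have hypos : 0 ≤ √2 * Real.exp (l + a / 2) := by positivity
  have hexp : M * σ ≤ M * σ * Real.exp a :=
    le_mul_of_one_le_right (by positivity) (Real.one_le_exp ha0)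
  have main : a / 2 - τ + M * (σ * Real.exp (2 * τ)) / 2 + M * σ / 2 ≤
      M * σ * Real.exp a + M := by
    rcases h with ⟨h2, rfl | h2'⟩ | ⟨rfl, h2⟩
    · have := mul_le_mul_of_nonneg_left h2 (show 0 ≤ M by linarith)
      nlinarith [mul_nonneg (show 0 ≤ M by linarith) hσ.le]
    · have e : σ * Real.exp a = 2 * Real.exp (a - 2 * τ) := by
        rw [show a = 2 * τ + (a - 2 * τ) by ring, Real.exp_add, ← mul_assoc, h2',
          add_sub_cancel_left]
      have h3 : a - 2 * τ ≤ Real.exp (a - 2 * τ) := by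
        linarith [Real.add_one_le_exp (a - 2 * τ)]
      have h4 : Real.exp (a - 2 * τ) ≤ M * Real.exp (a - 2 * τ) :=
        le_mul_of_one_le_left (Real.exp_pos _).le hM
      rw [mul_assoc M σ (Real.exp a), e] at hexp ⊢
      rw [h2']
      linarith [Real.exp_pos (a - 2 * τ)]
    · simp only [mul_zero, Real.exp_zero, mul_one]
      have h3 := mul_le_mul_of_nonneg_left (Real.add_one_le_exp a)
        (show 0 ≤ M * σ by positivity)
      have h4 : 1 ≤ M * σ := by nlinarith
      nlinarith [mul_le_mul_of_nonneg_right h4 ha0]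
  rw [hlog4]
  nlinarith [main, hy', hlog23, hypos]

lemma exists_switching_time {σ a : ℝ} (hσ : 0 < σ) (ha : 0 ≤ a) :
    ∃ τ, 0 ≤ τ ∧ τ ≤ a ∧
      (σ * Real.exp (2 * τ) ≤ 2 ∧ (τ = a ∨ σ * Real.exp (2 * τ) = 2) ∨ τ = 0 ∧ 2 ≤ σ) := by
  by_cases h2 : 2 ≤ σ
  · exact ⟨0, le_rfl, ha, Or.inr ⟨rfl, h2⟩⟩
  by_cases h3 : σ * Real.exp (2 * a) ≤ 2
  · exact ⟨a, ha, le_rfl, Or.inl ⟨h3, Or.inl rfl⟩⟩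
  push Not at h2 h3
  have e : σ * Real.exp (2 * (Real.log (2 / σ) / 2)) = 2 := by
    rw [mul_div_cancel₀ _ two_ne_zero, Real.exp_log (by positivity)]
    field_simp
  refine ⟨Real.log (2 / σ) / 2, ?_, ?_, Or.inl ⟨e.le, Or.inr e⟩⟩
  · have : 0 ≤ Real.log (2 / σ) := Real.log_nonneg (by rw [le_div_iff₀ hσ]; linarith)
    linarith
  · have : Real.log (2 / σ) ≤ 2 * a := by
      rw [Real.log_le_iff_le_exp (by positivity), div_le_iff₀ hσ]
      linarith
    linarith

lemma pairs_mul_sqrt_le {n S : ℝ} (hn : 1 < n) (hS : 0 ≤ S) :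
    n * (n - 1) / 2 * √(2 * S / (n - 1)) ≤ n ^ ((3 : ℝ) / 2) * √(1 / 2 * S) := by
  have hn1 : 0 < n - 1 := by linarith
  have e : n ^ ((3 : ℝ) / 2) = n * √n := by
    rw [show (3 : ℝ) / 2 = 1 + 1 / 2 by norm_num, Real.rpow_add (by linarith), Real.rpow_one,
      ← Real.sqrt_eq_rpow]
  rw [e, mul_assoc, ← Real.sqrt_mul (by linarith), mul_div_assoc, mul_assoc]
  refine mul_le_mul_of_nonneg_left (Real.le_sqrt_of_sq_le ?_) (by linarith)
  rw [mul_pow, Real.sq_sqrt (by positivity)]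
  have : ((n - 1) / 2) ^ 2 * (2 * S / (n - 1)) = (n - 1) * (1 / 2 * S) := by
    field_simp
  rw [this]
  nlinarith

namespace IsLeapfrogSolution

variable {c R T : ℝ} {x y : ℝ → ι → ℝ}

lemma log_sqDist_ge (h : IsLeapfrogSolution c R T x y) (hc : 0 < c) (hR : 0 < R) (hT : 0 ≤ T)
    {i j : ι} (hij : i ≠ j) :
    2 * (1 / (4 * R ^ 2) * ∑ i, y 0 i ^ 2 +
        1 / 4 * ∑ i, ∑ j, Real.log (sqDist (x 0) (y 0) i j)) -
      2 * √2 * (Fintype.card ι : ℝ) ^ ((3 : ℝ) / 2) * √(1 / 2 * ∑ i, (x 0 i ^ 2 + y 0 i ^ 2)) *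
        Real.exp (c * T / 4) -
      (1 / 2 * ∑ i, (x 0 i ^ 2 + y 0 i ^ 2)) / R ^ 2 * Real.exp (c * T / 2) ≤
    1 / 2 * Real.log (sqDist (x T) (y T) i j) := by
  have hn2 : (2 : ℝ) ≤ Fintype.card ι := by
    have : Nontrivial ι := ⟨i, j, hij⟩
    exact_mod_cast Fintype.one_lt_card (α := ι)
  have hpos0 := h.sqDist_pos 0 (Set.left_mem_Icc.2 hT)
  have hposT := h.sqDist_pos T (Set.right_mem_Icc.2 hT)
  have hE := h.energy_eq hR hT
  have hmom := fun t ht => h.moment_le hc (t := t) ht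
  have hS : 0 < ∑ i, (x 0 i ^ 2 + y 0 i ^ 2) := by
    have h1 := single_le_sum (f := fun i => ∑ j, sqDist (x 0) (y 0) i j)
      (fun i _ => sum_nonneg fun j _ => sqDist_nonneg _ _ _ _) (mem_univ i)
    have h2 := single_le_sum (f := fun j => sqDist (x 0) (y 0) i j)
      (fun j _ => sqDist_nonneg _ _ _ _) (mem_univ j)
    have h3 := (hpos0 i j hij).trans_le (h2.trans (h1.trans (sum_sqDist_le _ _)))
    exact pos_of_mul_pos_right h3 (by positivity)
  have hsoft := fun {s : ℝ} (hs : 0 < s) hsR {t : ℝ} ht =>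
    h.softened_energy_le hc hR (s := s) hs hsR (t := t) ht
  have hsplit := fun {s : ℝ} (hs : 0 < s) => sum_log_sqDist_le_softened hposT hs hij
  have hlog0 := fun {A : ℝ} hA => sum_log_sqDist_le hpos0 (A := A) hA
  have hy2 : ∀ t, ∑ i, y t i ^ 2 ≤ ∑ i, (x t i ^ 2 + y t i ^ 2) := fun t =>
    sum_le_sum fun i _ => le_add_of_nonneg_left (sq_nonneg _)
  have hD := fun t => sum_sqDist_le (x t) (y t)
  have hsoftbd := fun {s : ℝ} (hs : 0 < s) t =>
    sum_log_one_add_sqDist_le (x := x t) (y := y t) hs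
  set n := (Fintype.card ι : ℝ)
  set S := ∑ i, (x 0 i ^ 2 + y 0 i ^ 2) with hSdef
  obtain ⟨M, hM⟩ : ∃ M, M = n * (n - 1) / 2 := ⟨_, rfl⟩
  have hM1 : 1 ≤ M := by rw [hM]; nlinarith
  have hn1 : 0 < n - 1 := by linarith
  have hnM : n * (n - 1) = 2 * M := by rw [hM]; ring
  obtain ⟨σ, hσ⟩ : ∃ σ, σ = S / (2 * R ^ 2) / M := ⟨_, rfl⟩
  have hMσ : M * σ = S / (2 * R ^ 2) := by rw [hσ]; field_simp
  have hσ0 : 0 < σ := by rw [hσ]; positivity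
  obtain ⟨A, hA⟩ : ∃ A, A = 2 * S / (n - 1) := ⟨_, rfl⟩
  have hA0 : 0 < A := by rw [hA]; positivity
  have hnA : n * (n - 1) * A = 2 * n * S := by rw [hA]; field_simp
  have hAσ : A = 2 * n * R ^ 2 * σ := by
    rw [hσ, hA, hM]
    have : n ≠ 0 := by linarith
    field_simp
  obtain ⟨τ, hτ0, hτa, hτ⟩ := exists_switching_time hσ0 (show 0 ≤ c * T / 2 by positivity)
  have hfin := exponent_ineq (l := Real.log A / 2) hM1 hσ0 hτa hτ0 hτ
  obtain ⟨t₁, ht₁⟩ : ∃ t₁, t₁ = 2 * τ / c := ⟨_, rfl⟩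
  have hct : c * t₁ = 2 * τ := by rw [ht₁]; field_simp
  have htmem : t₁ ∈ Set.Icc 0 T :=
    ⟨by rw [ht₁]; positivity, by rw [ht₁, div_le_iff₀ hc]; linarith⟩
  obtain ⟨s, hs⟩ : ∃ s, s = √(3 * A * Real.exp (2 * τ)) := ⟨_, rfl⟩
  have hs0 : 0 < s := by rw [hs]; positivity
  have hs2 : s ^ 2 = 3 * A * Real.exp (2 * τ) := by rw [hs]; exact Real.sq_sqrt (by positivity)
  have hlogs : Real.log (s ^ 2) = Real.log 3 + Real.log A + 2 * τ := by
    rw [hs2, Real.log_mul (by positivity) (by positivity), Real.log_mul (by norm_num) hA0.ne',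
      Real.log_exp]
  have hsoft' : 1 / (4 * R ^ 2) * ∑ i, y T i ^ 2 +
        1 / 4 * ∑ i, ∑ j, Real.log (1 + sqDist (x T) (y T) i j / s ^ 2) ≤
      1 / (4 * R ^ 2) * ∑ i, y t₁ i ^ 2 +
        1 / 4 * ∑ i, ∑ j, Real.log (1 + sqDist (x t₁) (y t₁) i j / s ^ 2) +
      M * (c * T / 2 - τ) := by
    have hcase : τ = c * T / 2 ∨ 2 ≤ σ * Real.exp (2 * τ) := by
      rcases hτ with ⟨_, h1 | h1⟩ | ⟨rfl, h1⟩
      · exact Or.inl h1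
      · exact Or.inr h1.ge
      · exact Or.inr (by simpa using h1)
    rcases hcase with h1 | h1
    · have : t₁ = T := by rw [ht₁, h1]; field_simp
      rw [this, h1, sub_self, mul_zero, add_zero]
    · have h2 : 8 * n * R ^ 2 ≤ s ^ 2 := by
        rw [hs2, hAσ]
        nlinarith [mul_le_mul_of_nonneg_left h1 (show 0 ≤ n * R ^ 2 by positivity)]
      refine (hsoft hs0 h2 htmem).trans_eq ?_
      rw [hnM]
      linear_combination (-M / 2) * hct
  have hmom1 := hmom t₁ htmem
  rw [hct] at hmom1
  have hD1 : ∑ i, ∑ j, sqDist (x t₁) (y t₁) i j ≤ n * (n - 1) * (s ^ 2 / 3) := by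
    refine (hD t₁).trans ?_
    rw [hs2, show n * (n - 1) * (3 * A * Real.exp (2 * τ) / 3) =
      n * (n - 1) * A * Real.exp (2 * τ) by ring, hnA]
    nlinarith [mul_le_mul_of_nonneg_left hmom1 (show 0 ≤ 2 * n by linarith)]
  have hbd1 := hsoftbd hs0 t₁ hD1
  have hbd0 := hlog0 hA0 ((hD 0).trans_eq hnA.symm)
  have hspl := hsplit hs0
  rw [hnM] at hbd1 hbd0 hspl
  rw [hlogs] at hspl
  have hr1 : 1 / (4 * R ^ 2) * ∑ i, y t₁ i ^ 2 ≤ M * σ * Real.exp (2 * τ) / 2 := by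
    refine (mul_le_mul_of_nonneg_left ((hy2 t₁).trans hmom1) (by positivity)).trans_eq ?_
    rw [hMσ]; field_simp; ring
  have hr0 : 1 / (4 * R ^ 2) * ∑ i, y 0 i ^ 2 ≤ M * σ / 2 := by
    refine (mul_le_mul_of_nonneg_left (hy2 0) (by positivity)).trans_eq ?_
    rw [hMσ]; field_simp; ring
  have hP : 2 * √2 * M * Real.exp (Real.log A / 2 + c * T / 2 / 2) ≤
      2 * √2 * n ^ ((3 : ℝ) / 2) * √(1 / 2 * S) * Real.exp (c * T / 4) := by
    have e1 : Real.exp (Real.log A / 2 + c * T / 2 / 2) = √A * Real.exp (c * T / 4) := by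
      rw [Real.exp_add, ← Real.log_sqrt hA0.le, Real.exp_log (by positivity)]
      congr 2; ring
    have e2 : M * √A ≤ n ^ ((3 : ℝ) / 2) * √(1 / 2 * S) := by
      rw [hM, hA]; exact pairs_mul_sqrt_le (by linarith) hS.le
    rw [e1]
    have := mul_le_mul_of_nonneg_right e2
      (show 0 ≤ 2 * √2 * Real.exp (c * T / 4) by positivity)
    linarith
  have hρ : 1 / 2 * S / R ^ 2 = M * σ := by rw [hMσ]; field_simp
  rw [hρ]
  linarith

end IsLeapfrogSolution

end Bounds

section Conversion

variable {N : ℕ}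

lemma norm_sub_sq_eq_sqDist (q : Fin N → EuclideanSpace ℝ (Fin 2)) (i j : Fin N) :
    ‖q i - q j‖ ^ 2 = sqDist (fun i => q i 0) (fun i => q i 1) i j := by
  simp [EuclideanSpace.real_norm_sq_eq, Fin.sum_univ_two, sqDist]

lemma log_norm_sub_eq (q : Fin N → EuclideanSpace ℝ (Fin 2)) (i j : Fin N) :
    Real.log ‖q i - q j‖ =
      1 / 2 * Real.log (sqDist (fun i => q i 0) (fun i => q i 1) i j) := by
  rw [← norm_sub_sq_eq_sqDist, Real.log_pow]
  push_cast
  ring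

lemma H0_eq (R : ℝ) (q : Fin N → EuclideanSpace ℝ (Fin 2)) :
    H0 N R q = 1 / (4 * R ^ 2) * ∑ i, q i 1 ^ 2 +
      1 / 4 * ∑ i, ∑ j, Real.log (sqDist (fun i => q i 0) (fun i => q i 1) i j) := by
  have h : ∀ i, ∑ j ∈ univ.erase i, Real.log ‖q i - q j‖ =
      1 / 2 * ∑ j, Real.log (sqDist (fun i => q i 0) (fun i => q i 1) i j) := by
    intro i
    rw [sum_erase _ (by simp), mul_sum]
    exact sum_congr rfl fun j _ => log_norm_sub_eq q i j
  simp only [H0, h, ← mul_sum]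
  ring

lemma Imom_eq (q : Fin N → EuclideanSpace ℝ (Fin 2)) :
    Imom N q = 1 / 2 * ∑ i, (q i 0 ^ 2 + q i 1 ^ 2) := by
  simp [Imom, EuclideanSpace.real_norm_sq_eq, Fin.sum_univ_two]

lemma lfRHS_zero (γ : ℝ) {R : ℝ} (hR : R ≠ 0) (q : Fin N → EuclideanSpace ℝ (Fin 2))
    (i : Fin N) : lfRHS N γ R q i 0 =
      velX (γ / (4 * Real.pi * R ^ 2)) R (fun i => q i 0) (fun i => q i 1) i := by
  rw [lfRHS, sum_erase _ (by simp)]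
  simp only [norm_sub_sq_eq_sqDist, velX, gradSum, perp, ez, PiLp.sub_apply, PiLp.smul_apply,
    WithLp.ofLp_sum, Finset.sum_apply, WithLp.equiv_symm_apply, Matrix.cons_val_zero,
    smul_eq_mul, mul_neg, sum_neg_distrib, mul_one]
  field_simp
  ring

lemma lfRHS_one (γ : ℝ) {R : ℝ} (hR : R ≠ 0) (q : Fin N → EuclideanSpace ℝ (Fin 2))
    (i : Fin N) : lfRHS N γ R q i 1 =
      velY (γ / (4 * Real.pi * R ^ 2)) R (fun i => q i 0) (fun i => q i 1) i := by
  rw [lfRHS, sum_erase _ (by simp)]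
  simp only [norm_sub_sq_eq_sqDist, velY, gradSum, perp, ez, PiLp.sub_apply, PiLp.smul_apply,
    WithLp.ofLp_sum, Finset.sum_apply, WithLp.equiv_symm_apply, Matrix.cons_val_one,
    Matrix.cons_val_fin_one, smul_eq_mul, mul_zero, sub_zero]
  field_simp
  ring

end Conversion

/-- No collision in finite time: along any `C¹` collisionless solution of the limiting
leapfrogging point system on `[0, T]`, the mutual distances admit the explicit positive
lower bound
`min(1, exp(2H₀(q(0)) − 2√2·N^{3/2}·√(I(0))·e^{γT/(16π(r*)²)} − (I(0)/(r*)²)·e^{γT/(8π(r*)²)}))`. -/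
theorem stmt_13 (N : ℕ) (hN : 2 ≤ N) (γ rstar T : ℝ) (hγ : 0 < γ) (hr : 0 < rstar)
    (hT : 0 < T)
    (q : ℝ → Fin N → EuclideanSpace ℝ (Fin 2))
    (hsep : ∀ t ∈ Set.Icc (0:ℝ) T, ∀ i j, i ≠ j → q t i ≠ q t j)
    (hode : ∀ i, ∀ t ∈ Set.Icc (0:ℝ) T,
      HasDerivWithinAt (fun s => q s i) (lfRHS N γ rstar (q t) i) (Set.Icc 0 T) t) :
    ∀ t ∈ Set.Icc (0:ℝ) T, ∀ i j, i ≠ j →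
      ‖q t i - q t j‖ ≥
        min 1 (Real.exp (2 * H0 N rstar (q 0)
          - 2 * Real.sqrt 2 * (N:ℝ) ^ ((3:ℝ)/2) * Real.sqrt (Imom N (q 0))
              * Real.exp (γ * T / (16*Real.pi*rstar^2))
          - (Imom N (q 0) / rstar^2) * Real.exp (γ * T / (8*Real.pi*rstar^2)))) := by
  intro t ht i j hij
  have hpi := Real.pi_pos
  have hc : 0 < γ / (4 * Real.pi * rstar ^ 2) := by positivity
  have hcoord : ∀ (k : Fin 2) (i : Fin N), ∀ t ∈ Set.Icc (0 : ℝ) T, HasDerivWithinAt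
      (fun s => q s i k) (lfRHS N γ rstar (q t) i k) (Set.Icc 0 T) t := fun k i t ht =>
    (EuclideanSpace.proj k : EuclideanSpace ℝ (Fin 2) →L[ℝ] ℝ).hasFDerivAt.comp_hasDerivWithinAt
      t (hode i t ht)
  have hpos : ∀ t ∈ Set.Icc (0 : ℝ) T, ∀ i j, i ≠ j →
      0 < sqDist (fun i => q t i 0) (fun i => q t i 1) i j := fun t ht i j hij => by
    rw [← norm_sub_sq_eq_sqDist]
    have := norm_pos_iff.2 (sub_ne_zero.2 (hsep t ht i j hij))
    positivity
  have hsol : IsLeapfrogSolution (γ / (4 * Real.pi * rstar ^ 2)) rstar T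
      (fun t i => q t i 0) (fun t i => q t i 1) :=
    ⟨hpos, fun t ht i => (hcoord 0 i t ht).congr_deriv (lfRHS_zero γ hr.ne' (q t) i),
      fun t ht i => (hcoord 1 i t ht).congr_deriv (lfRHS_one γ hr.ne' (q t) i)⟩
  have hmain := (hsol.mono ht.2).log_sqDist_ge hc hr ht.1 hij
  rw [← H0_eq rstar (q 0), ← Imom_eq (q 0), ← log_norm_sub_eq (q t), Fintype.card_fin] at hmain
  have hI : 0 ≤ Imom N (q 0) := by unfold Imom; positivity
  have e4 : Real.exp (γ / (4 * Real.pi * rstar ^ 2) * t / 4) ≤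
      Real.exp (γ * T / (16 * Real.pi * rstar ^ 2)) := by
    rw [Real.exp_le_exp, show γ / (4 * Real.pi * rstar ^ 2) * t / 4 =
      γ * t / (16 * Real.pi * rstar ^ 2) by field_simp; ring]
    gcongr
    exact ht.2
  have e2 : Real.exp (γ / (4 * Real.pi * rstar ^ 2) * t / 2) ≤
      Real.exp (γ * T / (8 * Real.pi * rstar ^ 2)) := by
    rw [Real.exp_le_exp, show γ / (4 * Real.pi * rstar ^ 2) * t / 2 =
      γ * t / (8 * Real.pi * rstar ^ 2) by field_simp; ring]
    gcongr
    exact ht.2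
  refine (min_le_right _ _).trans ?_
  rw [← Real.le_log_iff_exp_le (norm_pos_iff.2 (sub_ne_zero.2 (hsep t ht i j hij)))]
  refine le_trans ?_ hmain
  gcongr
end
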